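/- arXiv:1105.0140 — 2 statements merged into one kernel-verified Lean document; each statement's English description precedes it below -/
import Mathlib

section
/- Let Z be a path-connected compact metrizable space, let G be a countable sofic group with sofic approximation sequence Σ, and consider the left shift action of G on X = Z^G. Then for any nontrivial factor Y of X (i.e., a compact metrizable space with more than one point, carrying a continuous G-action, together with a continuous surjective G-equivariant map X → Y), one has mdim_Σ(Y) > 0. -/
open Filter Topology TopologicalSpace
open scoped ENat
open scoped Classical Pointwise

namespace SoficMD

/-- A sofic approximation sequence for a group `G`. -/
structure SoficApprox (G : Type*) [Group G] where
  d : ℕ → ℕ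
  σ : ∀ i, G → Equiv.Perm (Fin (d i))
  approx_mul : ∀ s t : G, Tendsto
    (fun i => ((Finset.univ.filter fun a : Fin (d i) => σ i s (σ i t a) = σ i (s * t) a).card : ℝ) / (d i : ℝ))
    atTop (𝓝 1)
  approx_sep : ∀ s t : G, s ≠ t → Tendsto
    (fun i => ((Finset.univ.filter fun a : Fin (d i) => σ i s a = σ i t a).card : ℝ) / (d i : ℝ))
    atTop (𝓝 0)
  d_tendsto : Tendsto d atTop atTop

/-- A continuous pseudometric on a topological space. -/
structure ContPseudoMetric (X : Type*) [TopologicalSpace X] where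
  d : X → X → ℝ
  continuous' : Continuous fun p : X × X => d p.1 p.2
  nonneg : ∀ x y, 0 ≤ d x y
  symm : ∀ x y, d x y = d y x
  refl : ∀ x, d x x = 0
  triangle : ∀ x y z, d x z ≤ d x y + d y z

/-- A continuous pseudometric on a compact Hausdorff space is a compatible metric iff it
separates points. -/
def ContPseudoMetric.IsCompatMetric {X : Type*} [TopologicalSpace X]
    (ρ : ContPseudoMetric X) : Prop :=
  ∀ x y : X, ρ.d x y = 0 → x = y

/-- A continuous pseudometric is dynamically generating if translates separate points. -/
def DynGenerating (G : Type*) {X : Type*} [Group G] [TopologicalSpace X] [MulAction G X]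
    (ρ : ContPseudoMetric X) : Prop :=
  ∀ x y : X, x ≠ y → ∃ s : G, 0 < ρ.d (s • x) (s • y)

/-- Equivariance of a map between two `G`-spaces. -/
def Equivariant (G : Type*) {A B : Type*} [SMul G A] [SMul G B] (f : A → B) : Prop :=
  ∀ (s : G) (a : A), f (s • a) = s • f a

/-- The normalized ℓ² pseudometric on maps `[d] → X`. -/
noncomputable def rho2 {X : Type*} [TopologicalSpace X] (ρ : ContPseudoMetric X) {d : ℕ}
    (φ ψ : Fin d → X) : ℝ :=
  Real.sqrt ((1 / (d : ℝ)) * ∑ a, (ρ.d (φ a) (ψ a)) ^ 2)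

/-- The ℓ^∞ pseudometric on maps `[d] → X`. -/
noncomputable def rhoInfty {X : Type*} [TopologicalSpace X] (ρ : ContPseudoMetric X) {d : ℕ}
    (φ ψ : Fin d → X) : ℝ :=
  ⨆ a : Fin d, ρ.d (φ a) (ψ a)

/-- The space of `(ρ, F, δ)`-approximately equivariant maps `[d] → X` relative to `σ`. -/
def MapSpace {G X : Type*} [Group G] [TopologicalSpace X] [MulAction G X]
    (ρ : ContPseudoMetric X) (F : Finset G) (δ : ℝ) {d : ℕ}
    (σ : G → Equiv.Perm (Fin d)) : Set (Fin d → X) :=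
  {φ | ∀ s ∈ F, rho2 ρ (fun a => φ (σ s a)) (fun a => s • φ a) ≤ δ}

/-- A finite open cover. -/
def IsFinOpenCover {Y : Type*} [TopologicalSpace Y] (𝒰 : Finset (Set Y)) : Prop :=
  (∀ U ∈ 𝒰, IsOpen U) ∧ (⋃ U ∈ 𝒰, U) = Set.univ

/-- `𝒱` refines `𝒰`. -/
def Refines {Y : Type*} (𝒱 𝒰 : Finset (Set Y)) : Prop :=
  ∀ V ∈ 𝒱, ∃ U ∈ 𝒰, V ⊆ U

/-- `ord` of a finite family of sets: the maximal multiplicity minus one. -/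
noncomputable def coverOrd {Y : Type*} (𝒰 : Finset (Set Y)) : EReal :=
  (⨆ y : Y, (((𝒰.filter fun U => y ∈ U).card : ℝ) : EReal)) - 1

/-- `D(𝒰)`: the infimum of `ord 𝒱` over finite open covers `𝒱` refining `𝒰`. -/
noncomputable def coverD {Y : Type*} [TopologicalSpace Y] (𝒰 : Finset (Set Y)) : EReal :=
  ⨅ 𝒱 ∈ {𝒱 : Finset (Set Y) | IsFinOpenCover 𝒱 ∧ Refines 𝒱 𝒰}, coverOrd 𝒱

/-- the product cover `𝒰^d` of `Y^[d]`. -/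
noncomputable def prodCover {Y : Type*} (𝒰 : Finset (Set Y)) (d : ℕ) :
    Finset (Set (Fin d → Y)) :=
  (Fintype.piFinset fun _ : Fin d => 𝒰).image fun U => {φ | ∀ a, φ a ∈ U a}

/-- restriction of a cover to a subset, viewed as a cover of the subtype. -/
noncomputable def restrictCover {Y : Type*} (𝒰 : Finset (Set Y)) (Z : Set Y) :
    Finset (Set Z) :=
  𝒰.image fun U => (Subtype.val ⁻¹' U : Set Z)

/-- `D(𝒰, ρ, F, δ, σ)`. -/
noncomputable def coverDMap {G X : Type*} [Group G] [TopologicalSpace X] [MulAction G X]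
    (𝒰 : Finset (Set X)) (ρ : ContPseudoMetric X) (F : Finset G) (δ : ℝ) {d : ℕ}
    (σ : G → Equiv.Perm (Fin d)) : EReal :=
  coverD (restrictCover (prodCover 𝒰 d) (MapSpace ρ F δ σ))

/-- `D_Σ(𝒰, ρ, F, δ)`. -/
noncomputable def DSigmaFdel {G X : Type*} [Group G] [TopologicalSpace X] [MulAction G X]
    (Sap : SoficApprox G) (𝒰 : Finset (Set X)) (ρ : ContPseudoMetric X)
    (F : Finset G) (δ : ℝ) : EReal :=
  limsup (fun i => coverDMap 𝒰 ρ F δ (Sap.σ i) * ((Sap.d i : ℝ)⁻¹ : EReal)) atTop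

/-- `D_Σ(𝒰, ρ, F)`. -/
noncomputable def DSigmaF {G X : Type*} [Group G] [TopologicalSpace X] [MulAction G X]
    (Sap : SoficApprox G) (𝒰 : Finset (Set X)) (ρ : ContPseudoMetric X)
    (F : Finset G) : EReal :=
  ⨅ δ : {δ : ℝ // 0 < δ}, DSigmaFdel Sap 𝒰 ρ F δ.1

/-- `D_Σ(𝒰, ρ)`. -/
noncomputable def DSigmaU {G X : Type*} [Group G] [TopologicalSpace X] [MulAction G X]
    (Sap : SoficApprox G) (𝒰 : Finset (Set X)) (ρ : ContPseudoMetric X) : EReal :=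
  ⨅ F : {F : Finset G // F.Nonempty}, DSigmaF Sap 𝒰 ρ F.1

/-- the sofic mean topological dimension `mdim_Σ(X, ρ)`. -/
noncomputable def mdimSigma {G X : Type*} [Group G] [TopologicalSpace X] [MulAction G X]
    (Sap : SoficApprox G) (ρ : ContPseudoMetric X) : EReal :=
  ⨆ 𝒰 ∈ {𝒰 : Finset (Set X) | IsFinOpenCover 𝒰}, DSigmaU Sap 𝒰 ρ

/-- `N_ε(Y, ρ)`: the maximal cardinality of `ε`-separated subsets. -/
noncomputable def sepNum {Y : Type*} (ρ : Y → Y → ℝ) (ε : ℝ) : ℕ∞ :=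
  ⨆ E ∈ {E : Set Y | ∀ x ∈ E, ∀ y ∈ E, x ≠ y → ε ≤ ρ x y}, E.encard

/-- The extended-real logarithm of an extended natural number. -/
noncomputable def elog (n : ℕ∞) : EReal :=
  if n = ⊤ then ⊤ else if n = 0 then ⊥ else ((Real.log n.toNat : ℝ) : EReal)

/-- `log N_ε(Map(ρ,F,δ,σ), ρ_∞)`. -/
noncomputable def hCnt {G X : Type*} [Group G] [TopologicalSpace X] [MulAction G X]
    (ρ : ContPseudoMetric X) (F : Finset G) (δ : ℝ) {d : ℕ}
    (σ : G → Equiv.Perm (Fin d)) (ε : ℝ) : EReal :=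
  elog (sepNum (fun φ ψ : MapSpace ρ F δ σ => rhoInfty ρ φ.1 ψ.1) ε)

/-- `h^ε_{Σ,∞}(ρ, F, δ)`. -/
noncomputable def hEpsFdel {G X : Type*} [Group G] [TopologicalSpace X] [MulAction G X]
    (Sap : SoficApprox G) (ρ : ContPseudoMetric X) (ε : ℝ) (F : Finset G) (δ : ℝ) : EReal :=
  limsup (fun i => hCnt ρ F δ (Sap.σ i) ε * ((Sap.d i : ℝ)⁻¹ : EReal)) atTop

/-- `h^ε_{Σ,∞}(ρ)`. -/
noncomputable def hEps {G X : Type*} [Group G] [TopologicalSpace X] [MulAction G X]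
    (Sap : SoficApprox G) (ρ : ContPseudoMetric X) (ε : ℝ) : EReal :=
  ⨅ F : {F : Finset G // F.Nonempty}, ⨅ δ : {δ : ℝ // 0 < δ}, hEpsFdel Sap ρ ε F.1 δ.1

/-- The sofic mean metric dimension `mdim_{Σ,M}(X, ρ)`. -/
noncomputable def mdimSigmaM {G X : Type*} [Group G] [TopologicalSpace X] [MulAction G X]
    (Sap : SoficApprox G) (ρ : ContPseudoMetric X) : EReal :=
  liminf (fun ε : ℝ => hEps Sap ρ ε * ((|Real.log ε|⁻¹ : ℝ) : EReal)) (𝓝[>] (0 : ℝ))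

/-- The sofic mean metric dimension `mdim_{Σ,M}(X)`. -/
noncomputable def mdimSigmaMFull {G : Type*} [Group G] (Sap : SoficApprox G)
    (X : Type*) [TopologicalSpace X] [MulAction G X] : EReal :=
  ⨅ ρ : {ρ : ContPseudoMetric X // ρ.IsCompatMetric}, mdimSigmaM Sap ρ.1

/-- Følner-type characterization of amenability of a discrete group. -/
def AmenableF (G : Type*) [Group G] : Prop :=
  ∀ (K : Finset G) (ε : ℝ), 0 < ε →
    ∃ F : Finset G, F.Nonempty ∧ (((K * F) \ F).card : ℝ) < ε * F.card

/-- The set of `(K, ε)`-invariant nonempty finite subsets of `G`. -/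
noncomputable def FolnerSets {G : Type*} [Group G] (K : Finset G) (ε : ℝ) :
    Set (Finset G) :=
  {F | F.Nonempty ∧ (((K * F) \ F).card : ℝ) < ε * F.card}

/-- The cover `𝒰^F = ⋁_{s ∈ F} s⁻¹ 𝒰`. -/
noncomputable def coverJoin {G X : Type*} [Group G] [TopologicalSpace X] [MulAction G X]
    (𝒰 : Finset (Set X)) (F : Finset G) : Finset (Set X) :=
  (F.pi fun _ => 𝒰).image fun f => ⋂ s, ⋂ (h : s ∈ F), (fun x : X => s • x) ⁻¹' f s h

/-- `mdim(𝒰)` as an inf-sup over more and more invariant sets. -/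
noncomputable def mdimCoverIS {G X : Type*} [Group G] [TopologicalSpace X] [MulAction G X]
    (𝒰 : Finset (Set X)) : EReal :=
  ⨅ K : Finset G, ⨅ ε : {ε : ℝ // 0 < ε},
    ⨆ F ∈ FolnerSets K ε.1, coverD (coverJoin 𝒰 F) * ((F.card : ℝ)⁻¹ : EReal)

/-- `mdim(𝒰)` as a sup-inf over more and more invariant sets. -/
noncomputable def mdimCoverSI {G X : Type*} [Group G] [TopologicalSpace X] [MulAction G X]
    (𝒰 : Finset (Set X)) : EReal :=
  ⨆ K : Finset G, ⨆ ε : {ε : ℝ // 0 < ε},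
    ⨅ F ∈ FolnerSets K ε.1, coverD (coverJoin 𝒰 F) * ((F.card : ℝ)⁻¹ : EReal)

/-- mean topological dimension, inf-sup form. -/
noncomputable def mdimIS (G X : Type*) [Group G] [TopologicalSpace X] [MulAction G X] :
    EReal :=
  ⨆ 𝒰 ∈ {𝒰 : Finset (Set X) | IsFinOpenCover 𝒰}, mdimCoverIS (G := G) 𝒰

/-- mean topological dimension, sup-inf form. -/
noncomputable def mdimSI (G X : Type*) [Group G] [TopologicalSpace X] [MulAction G X] :
    EReal :=
  ⨆ 𝒰 ∈ {𝒰 : Finset (Set X) | IsFinOpenCover 𝒰}, mdimCoverSI (G := G) 𝒰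

/-- the pseudometric `ρ_F(x,y) = max_{s ∈ F} ρ(sx, sy)`. -/
noncomputable def rhoF {G X : Type*} [Group G] [TopologicalSpace X] [MulAction G X]
    (ρ : ContPseudoMetric X) (F : Finset G) (x y : X) : ℝ :=
  ⨆ s : F, ρ.d ((s : G) • x) ((s : G) • y)

/-- diameter of a set w.r.t. a pseudometric given as a function. -/
noncomputable def diamP {Y : Type*} (ρ : Y → Y → ℝ) (U : Set Y) : ℝ :=
  ⨆ x : U, ⨆ y : U, ρ x y

/-- mesh of a finite cover w.r.t. a pseudometric given as a function. -/
noncomputable def meshP {Y : Type*} (ρ : Y → Y → ℝ) (𝒰 : Finset (Set Y)) : ℝ :=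
  ⨆ U : 𝒰, diamP ρ U.1

/-- minimal cardinality of a finite open cover of mesh `< ε`. -/
noncomputable def minCoverCard {Y : Type*} [TopologicalSpace Y] (ρ : Y → Y → ℝ) (ε : ℝ) : ℕ :=
  sInf {n : ℕ | ∃ 𝒰 : Finset (Set Y), IsFinOpenCover 𝒰 ∧ meshP ρ 𝒰 < ε ∧ 𝒰.card = n}

/-- `S(X, ε, ρ)` in inf-sup form. -/
noncomputable def SamenIS {G X : Type*} [Group G] [TopologicalSpace X] [MulAction G X]
    (ρ : ContPseudoMetric X) (ε : ℝ) : EReal :=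
  ⨅ K : Finset G, ⨅ δ : {δ : ℝ // 0 < δ},
    ⨆ F ∈ FolnerSets K δ.1,
      ((Real.log (minCoverCard (rhoF ρ F) ε) / F.card : ℝ) : EReal)

/-- `S(X, ε, ρ)` in sup-inf form. -/
noncomputable def SamenSI {G X : Type*} [Group G] [TopologicalSpace X] [MulAction G X]
    (ρ : ContPseudoMetric X) (ε : ℝ) : EReal :=
  ⨆ K : Finset G, ⨆ δ : {δ : ℝ // 0 < δ},
    ⨅ F ∈ FolnerSets K δ.1,
      ((Real.log (minCoverCard (rhoF ρ F) ε) / F.card : ℝ) : EReal)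

/-- mean metric dimension `mdim_M(X, ρ)`, inf-sup form. -/
noncomputable def mdimMIS {G X : Type*} [Group G] [TopologicalSpace X] [MulAction G X]
    (ρ : ContPseudoMetric X) : EReal :=
  liminf (fun ε : ℝ => SamenIS (G := G) ρ ε * ((|Real.log ε|⁻¹ : ℝ) : EReal)) (𝓝[>] (0 : ℝ))

/-- mean metric dimension `mdim_M(X, ρ)`, sup-inf form. -/
noncomputable def mdimMSI {G X : Type*} [Group G] [TopologicalSpace X] [MulAction G X]
    (ρ : ContPseudoMetric X) : EReal :=
  liminf (fun ε : ℝ => SamenSI (G := G) ρ ε * ((|Real.log ε|⁻¹ : ℝ) : EReal)) (𝓝[>] (0 : ℝ))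

/-- The covering dimension of a topological space, as an extended natural number. -/
noncomputable def covDim (Y : Type*) [TopologicalSpace Y] : ℕ∞ :=
  sInf {n : ℕ∞ | ∀ 𝒰 : Finset (Set Y), IsFinOpenCover 𝒰 →
    ∃ 𝒱 : Finset (Set Y), IsFinOpenCover 𝒱 ∧ Refines 𝒱 𝒰 ∧
      ∀ y : Y, (((𝒱.filter fun V => y ∈ V).card : ℕ∞)) ≤ n + 1}

/-- conversion of extended naturals into extended reals. -/
noncomputable def enatToEReal (n : ℕ∞) : EReal :=
  if n = ⊤ then ⊤ else ((n.toNat : ℝ) : EReal)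

/-- The action of `G` on a `G`-invariant subset. -/
def invariantSubMulAction {G X : Type*} [Group G] [MulAction G X] (Y : Set X)
    (h : ∀ (s : G), ∀ x ∈ Y, s • x ∈ Y) : MulAction G Y where
  smul s y := ⟨s • (y : X), h s y y.2⟩
  one_smul y := Subtype.ext (one_smul G (y : X))
  mul_smul s t y := Subtype.ext (mul_smul s t (y : X))

end SoficMD


open Filter Topology TopologicalSpace
open scoped ENat
open scoped Classical Pointwise

namespace SoficMD

section Shift

variable (G : Type*) [Group G] (Z : Type*)

/-- The left shift action of `G` on `Z^G`: `(s • x)_t = x_{s⁻¹ t}`. -/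
instance shiftSMul : SMul G (G → Z) :=
  ⟨fun s x t => x (s⁻¹ * t)⟩

instance shiftMulAction : MulAction G (G → Z) where
  one_smul x := funext fun t => by
    show x (1⁻¹ * t) = x t
    rw [inv_one, one_mul]
  mul_smul s t x := funext fun u => by
    show x ((s * t)⁻¹ * u) = x (t⁻¹ * (s⁻¹ * u))
    rw [mul_inv_rev, mul_assoc]

instance shiftContinuousConstSMul [TopologicalSpace Z] : ContinuousConstSMul G (G → Z) :=
  ⟨fun s => continuous_pi fun t => continuous_apply (s⁻¹ * t)⟩

end Shift

section CubicalCochains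

variable {ι : Type*}

/-- The mod 2 coboundary of a cubical cochain on the lattice `ι → ℕ`. The value of a cochain at
`J` and `v` is its value on the unit cube based at `v` with edge directions `J`. -/
noncomputable def cobdry (ω : Finset ι → (ι → ℕ) → ZMod 2) (J : Finset ι) (v : ι → ℕ) : ZMod 2 :=
  ∑ j ∈ J, (ω (J.erase j) (v + Pi.single j 1) - ω (J.erase j) v)

/-- The cup product of the coboundaries of the functions `f i`, for `i` in a list. -/
noncomputable def cupForm (f : ι → (ι → ℕ) → ZMod 2) :
    List ι → Finset ι → (ι → ℕ) → ZMod 2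
  | [] => fun J _ => if J = ∅ then 1 else 0
  | i :: l => cobdry fun J v => f i v * cupForm f l J v

lemma sum_erase_symm_eq_zero (J : Finset ι) (h : ι → ι → ZMod 2) (hh : ∀ j k, h j k = h k j) :
    ∑ j ∈ J, ∑ k ∈ J.erase j, h j k = 0 := by
  rw [Finset.sum_sigma']
  refine Finset.sum_involution (fun p _ => ⟨p.2, p.1⟩) ?_ ?_ ?_ ?_
  · rintro ⟨j, k⟩ _
    simp only [hh k j]
    exact CharTwo.add_self_eq_zero _
  · rintro ⟨j, k⟩ hp _ heq
    simp only [Finset.mem_sigma, Finset.mem_erase] at hp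
    simp only [Sigma.mk.injEq] at heq
    exact hp.2.1 heq.1
  · rintro ⟨j, k⟩ hp
    simp only [Finset.mem_sigma, Finset.mem_erase] at hp ⊢
    exact ⟨hp.2.2, fun h => hp.2.1 h.symm, hp.1⟩
  · rintro ⟨j, k⟩ _
    rfl

lemma cobdry_cobdry (ω : Finset ι → (ι → ℕ) → ZMod 2) (J : Finset ι) (v : ι → ℕ) :
    cobdry (cobdry ω) J v = 0 := by
  unfold cobdry
  simp_rw [← Finset.sum_sub_distrib]
  refine sum_erase_symm_eq_zero J (fun j k => _) fun j k => ?_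
  rw [Finset.erase_right_comm (a := j), add_right_comm v (Pi.single j 1)]
  ring

lemma cobdry_cupForm (f : ι → (ι → ℕ) → ZMod 2) (l : List ι) (J : Finset ι) (v : ι → ℕ) :
    cobdry (cupForm f l) J v = 0 := by
  cases l with
  | nil => simp [cobdry, cupForm]
  | cons i l => exact cobdry_cobdry _ J v

lemma cupForm_cons (f : ι → (ι → ℕ) → ZMod 2) (i : ι) (l : List ι) (J : Finset ι) (v : ι → ℕ) :
    cupForm f (i :: l) J v =
      ∑ j ∈ J, (f i (v + Pi.single j 1) - f i v) * cupForm f l (J.erase j) (v + Pi.single j 1) := by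
  have h := cobdry_cupForm f l J v
  rw [← sub_eq_zero, ← mul_zero (f i v), ← h]
  simp only [cupForm, cobdry]
  rw [Finset.mul_sum, ← Finset.sum_sub_distrib, ← sub_eq_zero, ← Finset.sum_sub_distrib]
  refine Finset.sum_eq_zero fun j _ => ?_
  ring

/-- The cup product vanishes on a cube on which one of the functions is constant. -/
lemma cupForm_eq_zero (f : ι → (ι → ℕ) → ZMod 2) {i : ι} {l : List ι} (hi : i ∈ l)
    (J : Finset ι) (v : ι → ℕ) (c : ZMod 2)
    (hf : ∀ w, (∀ j, v j ≤ w j) → (∀ j, w j ≤ v j + 1) → (∀ j ∉ J, w j = v j) → f i w = c) :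
    cupForm f l J v = 0 := by
  induction l generalizing J v with
  | nil => simp at hi
  | cons a l ih =>
    rw [cupForm_cons]
    refine Finset.sum_eq_zero fun j hj => ?_
    rcases List.mem_cons.1 hi with rfl | hi
    · rw [hf v (fun _ => le_rfl) (fun _ => Nat.le_succ _) (fun _ _ => rfl),
        hf (v + Pi.single j 1), sub_self, zero_mul]
      · intro k; simp
      · intro k
        by_cases hk : k = j
        · subst hk; simp
        · simp [hk]
      · intro k hk
        have : k ≠ j := fun h => hk (h ▸ hj)
        simp [this]
    · rw [ih hi, mul_zero]
      intro w h1 h2 h3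
      refine hf w (fun k => ?_) (fun k => ?_) (fun k hk => ?_)
      · exact le_trans (by simp) (h1 k)
      · by_cases hk : k = j
        · subst hk
          rw [h3 k (by simp)]; simp
        · simpa [hk] using h2 k
      · have : k ≠ j := fun h => hk (h ▸ hj)
        simpa [this] using h3 k (by simp [hk])

variable [Fintype ι]

/-- The lattice points with coordinates in `[0, m)` in the directions `J`, all others being `m`. -/
noncomputable def latticeBox (m : ℕ) (J : Finset ι) : Finset (ι → ℕ) :=
  Fintype.piFinset fun i => if i ∈ J then Finset.range m else {m}

lemma mem_latticeBox {m : ℕ} {J : Finset ι} {v : ι → ℕ} :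
    v ∈ latticeBox m J ↔ (∀ i ∈ J, v i < m) ∧ ∀ i ∉ J, v i = m := by
  simp only [latticeBox, Fintype.mem_piFinset]
  constructor
  · intro h
    exact ⟨fun i hi => by simpa [hi] using h i, fun i hi => by simpa [hi] using h i⟩
  · rintro ⟨h1, h2⟩ i
    by_cases hi : i ∈ J
    · simpa [hi] using h1 i hi
    · simpa [hi] using h2 i hi

lemma sum_latticeBox (m : ℕ) {J : Finset ι} {j : ι} (hj : j ∈ J) (h : (ι → ℕ) → ZMod 2) :
    ∑ v ∈ latticeBox m J, h v =
      ∑ w ∈ latticeBox m (J.erase j), ∑ t ∈ Finset.range m, h (Function.update w j t) := by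
  rw [← Finset.sum_product']
  refine Finset.sum_bij' (fun v _ => (Function.update v j m, v j))
    (fun p _ => Function.update p.1 j p.2) ?_ ?_ ?_ ?_ ?_
  · intro v hv
    rw [mem_latticeBox] at hv
    simp only [Finset.mem_product, mem_latticeBox, Finset.mem_range]
    refine ⟨⟨fun i hi => ?_, fun i hi => ?_⟩, hv.1 j hj⟩
    · rw [Finset.mem_erase] at hi
      simpa [hi.1] using hv.1 i hi.2
    · by_cases hij : i = j
      · subst hij; simp
      · simpa [hij] using hv.2 i fun h => hi (Finset.mem_erase.2 ⟨hij, h⟩)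
  · rintro ⟨w, t⟩ hp
    simp only [Finset.mem_product, mem_latticeBox, Finset.mem_range] at hp
    rw [mem_latticeBox]
    refine ⟨fun i hi => ?_, fun i hi => ?_⟩
    · by_cases hij : i = j
      · subst hij; simpa using hp.2
      · simpa [hij] using hp.1.1 i (Finset.mem_erase.2 ⟨hij, hi⟩)
    · have hij : i ≠ j := fun h => hi (h ▸ hj)
      simpa [hij] using hp.1.2 i fun h => hi (Finset.mem_erase.1 h).2
  · intro v _
    simp
  · rintro ⟨w, t⟩ hp
    simp only [Finset.mem_product, mem_latticeBox] at hp
    have : w j = m := hp.1.2 j (by simp)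
    simp [← this]
  · intro v _
    simp

lemma sum_latticeBox_sub (m : ℕ) {J : Finset ι} {j : ι} (hj : j ∈ J) (h : (ι → ℕ) → ZMod 2) :
    ∑ v ∈ latticeBox m J, (h (v + Pi.single j 1) - h v) =
      ∑ w ∈ latticeBox m (J.erase j), (h w - h (Function.update w j 0)) := by
  rw [sum_latticeBox m hj]
  refine Finset.sum_congr rfl fun w hw => ?_
  have hwj : w j = m := (mem_latticeBox.1 hw).2 j (by simp)
  have hstep : ∀ t, Function.update w j t + Pi.single j 1 = Function.update w j (t + 1) := by
    intro t
    ext k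
    by_cases hk : k = j
    · subst hk; simp
    · simp [hk]
  simp_rw [hstep]
  rw [Finset.sum_range_sub fun t => h (Function.update w j t), ← hwj, Function.update_eq_self]

lemma sum_cupForm (m : ℕ) (f : ι → (ι → ℕ) → ZMod 2) (h0 : ∀ i v, v i = 0 → f i v = 0)
    (h1 : ∀ i v, v i = m → f i v = 1) (l : List ι) (hl : l.Nodup) :
    ∑ v ∈ latticeBox m l.toFinset, cupForm f l l.toFinset v = 1 := by
  induction l with
  | nil =>
    have : latticeBox m (∅ : Finset ι) = {fun _ => m} := by
      ext v
      simp [mem_latticeBox, funext_iff]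
    simp [cupForm, this]
  | cons i l ih =>
    rw [List.nodup_cons] at hl
    have hi : i ∉ l.toFinset := by simpa using hl.1
    have herase : (i :: l).toFinset.erase i = l.toFinset := by
      rw [List.toFinset_cons, Finset.erase_insert hi]
    have hmem : i ∈ (i :: l).toFinset := by simp
    simp only [cupForm, cobdry]
    rw [Finset.sum_comm, ← Finset.add_sum_erase _ _ hmem,
      Finset.sum_eq_zero (s := (i :: l).toFinset.erase i), add_zero,
      sum_latticeBox_sub m hmem
        (fun v => f i v * cupForm f l ((i :: l).toFinset.erase i) v), herase, ← ih hl.2]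
    · refine Finset.sum_congr rfl fun w hw => ?_
      rw [h1 i w ((mem_latticeBox.1 hw).2 i hi), h0 i (Function.update w i 0) (by simp)]
      ring
    · intro j hj
      rw [herase] at hj
      have hjl : j ∈ l := by simpa using hj
      have hjm : j ∈ (i :: l).toFinset := by simp [hjl]
      rw [sum_latticeBox_sub m hjm
        (fun v => f i v * cupForm f l ((i :: l).toFinset.erase j) v)]
      refine Finset.sum_eq_zero fun w hw => ?_
      rw [cupForm_eq_zero f hjl _ w 1, cupForm_eq_zero f hjl _ (Function.update w j 0) 0]
      · ring
      · intro u _ _ hu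
        exact h0 j u (by simpa using hu j (by simp))
      · intro u _ _ hu
        exact h1 j u ((hu j (by simp)).trans ((mem_latticeBox.1 hw).2 j (by simp)))

/-- Discrete Poincaré–Miranda theorem: if each `f i` is `0` on the face `v i = 0` and `1` on the
face `v i = m` of a lattice cube, then there is a unit cell on which no `f i` is constant. -/
theorem exists_cell_forall_not_constant (m : ℕ) (f : ι → (ι → ℕ) → ZMod 2)
    (h0 : ∀ i v, v i = 0 → f i v = 0) (h1 : ∀ i v, v i = m → f i v = 1) :
    ∃ v : ι → ℕ, (∀ i, v i < m) ∧ ∀ i, ∀ c, ∃ w : ι → ℕ,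
      (∀ j, v j ≤ w j) ∧ (∀ j, w j ≤ v j + 1) ∧ f i w ≠ c := by
  have hsum := sum_cupForm m f h0 h1 Finset.univ.toList (Finset.nodup_toList _)
  obtain ⟨v, hv, hne⟩ := Finset.exists_ne_zero_of_sum_ne_zero (hsum.trans_ne one_ne_zero)
  refine ⟨v, fun i => (mem_latticeBox.1 hv).1 i (by simp), fun i c => ?_⟩
  by_contra! hcon
  exact hne (cupForm_eq_zero f (by simp) _ v c fun w hw1 hw2 _ => hcon w hw1 hw2)

end CubicalCochains

section LebesgueCovering

variable {X : Type*} [PseudoEMetricSpace X]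

/-- The points at which the members of `S` are deeper than all other members of `𝒱`, where the
depth of `x` in `V` is the distance of `x` to the complement of `V`. -/
def deepSet (𝒱 S : Finset (Set X)) : Set X :=
  {x | ∀ V ∈ S, x ∈ V ∧ ∀ V' ∈ 𝒱 \ S, Metric.infEDist x V'ᶜ < Metric.infEDist x Vᶜ}

lemma isOpen_deepSet {𝒱 S : Finset (Set X)} (h : ∀ V ∈ S, IsOpen V) : IsOpen (deepSet 𝒱 S) := by
  have : deepSet 𝒱 S = ⋂ V ∈ S, (V ∩ ⋂ V' ∈ 𝒱 \ S,
      {x | Metric.infEDist x V'ᶜ < Metric.infEDist x Vᶜ}) := by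
    ext x
    simp [deepSet]
  rw [this]
  refine isOpen_biInter_finset fun V hV => (h V hV).inter (isOpen_biInter_finset fun V' _ => ?_)
  exact isOpen_lt Metric.continuous_infEDist Metric.continuous_infEDist

lemma eq_of_mem_deepSet {𝒱 S S' : Finset (Set X)} (hS : S ⊆ 𝒱) (hS' : S' ⊆ 𝒱)
    (hcard : S.card = S'.card) {x : X} (hx : x ∈ deepSet 𝒱 S) (hx' : x ∈ deepSet 𝒱 S') :
    S = S' := by
  by_contra hne
  obtain ⟨V, hV, hVS'⟩ : ∃ V ∈ S, V ∉ S' := by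
    by_contra! hcon
    exact hne (Finset.eq_of_subset_of_card_le hcon hcard.ge)
  obtain ⟨V', hV', hVS⟩ : ∃ V ∈ S', V ∉ S := by
    by_contra! hcon
    exact hne (Finset.eq_of_subset_of_card_le hcon hcard.le).symm
  have h1 := (hx V hV).2 V' (Finset.mem_sdiff.2 ⟨hS' hV', hVS⟩)
  have h2 := (hx' V' hV').2 V (Finset.mem_sdiff.2 ⟨hS hV, hVS'⟩)
  exact lt_asymm h1 h2

lemma mem_deepSet_filter {𝒱 : Finset (Set X)} (h : ∀ V ∈ 𝒱, IsOpen V) (x : X) :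
    x ∈ deepSet 𝒱 (𝒱.filter fun V => x ∈ V) := by
  intro V hV
  rw [Finset.mem_filter] at hV
  refine ⟨hV.2, fun V' hV' => ?_⟩
  have hxV' : x ∉ V' := fun hx => by simp_all
  rw [Metric.infEDist_zero_of_mem (show x ∈ V'ᶜ from hxV'), pos_iff_ne_zero]
  intro h0
  have := (h V hV.1).isClosed_compl.closure_eq ▸ Metric.mem_closure_iff_infEDist_zero.2 h0
  exact this hV.2

/-- Lebesgue covering theorem: a finite open cover of a cube no member of which meets two opposite
faces has `n + 1` members with a common point, `n` being the dimension of the cube. -/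
theorem exists_card_lt_card_filter_mem {ι : Type*} [Fintype ι]
    (𝒱 : Finset (Set (ι → unitInterval))) (ho : ∀ V ∈ 𝒱, IsOpen V) (hcov : ∀ x, ∃ V ∈ 𝒱, x ∈ V)
    (hface : ∀ V ∈ 𝒱, ∀ i, (∀ x ∈ V, x i ≠ 0) ∨ (∀ x ∈ V, x i ≠ 1)) :
    ∃ x, Fintype.card ι < (𝒱.filter fun V => x ∈ V).card := by
  by_contra! hle
  set e := Fintype.equivFin ι
  -- the open cover by deep sets, and its Lebesgue number
  let 𝒮 : Set (Finset (Set (ι → unitInterval))) :=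
    {S | S ⊆ 𝒱 ∧ S.Nonempty ∧ S.card ≤ Fintype.card ι}
  obtain ⟨δ, hδ, hleb⟩ := lebesgue_number_lemma_of_metric (s := (Set.univ : Set (ι → unitInterval)))
    (c := fun S : 𝒮 => deepSet 𝒱 S.1) isCompact_univ
    (fun S => isOpen_deepSet fun V hV => ho V (S.2.1 hV)) (by
      intro x _
      obtain ⟨V, hV, hxV⟩ := hcov x
      exact Set.mem_iUnion.2 ⟨⟨𝒱.filter fun V => x ∈ V, Finset.filter_subset _ _,
        ⟨V, Finset.mem_filter.2 ⟨hV, hxV⟩⟩, hle x⟩, mem_deepSet_filter ho x⟩)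
  obtain ⟨m, hm⟩ := exists_nat_gt (1 / δ)
  have hm0 : (0 : ℝ) < m := lt_trans (by positivity) hm
  have hmδ : 1 / (m : ℝ) < δ := by
    rw [div_lt_iff₀ hm0]; rw [div_lt_iff₀ hδ] at hm; linarith
  -- the lattice points of the cube
  let p : (ι → ℕ) → ι → unitInterval := fun v i =>
    ⟨((min (v i) m : ℕ) : ℝ) / m, by positivity, by
      rw [div_le_one hm0]; exact_mod_cast min_le_right _ _⟩
  let near : ι → Set (ι → unitInterval) := fun i =>
    {x | x i = 0 ∨ ∃ S ∈ 𝒮, S.card = (e i : ℕ) + 1 ∧ x ∈ deepSet 𝒱 S ∧ ∃ y ∈ deepSet 𝒱 S, y i = 0}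
  let f : ι → (ι → ℕ) → ZMod 2 := fun i v => if p v ∈ near i then 0 else 1
  obtain ⟨v, hv, hcell⟩ := exists_cell_forall_not_constant m f
    (by
      intro i v hvi
      have : p v i = 0 := by ext; simp [p, hvi]
      simp [f, near, this])
    (by
      intro i v hvi
      have hpv : p v i = 1 := by ext; simp [p, hvi, hm0.ne']
      have : p v ∉ near i := by
        rintro (h | ⟨S, hS, -, hx, y, hy, hyi⟩)
        · simp [hpv] at h
        · obtain ⟨V, hV⟩ := hS.2.1
          rcases hface V (hS.1 hV) i with h | h
          · exact h y (hy V hV).1 hyi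
          · exact h _ (hx V hV).1 hpv
      simp [f, this])
  obtain ⟨⟨S, hS⟩, hball⟩ := hleb (p v) trivial
  have hmem : ∀ w : ι → ℕ, (∀ j, v j ≤ w j) → (∀ j, w j ≤ v j + 1) → p w ∈ deepSet 𝒱 S := by
    intro w hw1 hw2
    refine hball (lt_of_le_of_lt ((dist_pi_le_iff (by positivity)).2 fun j => ?_) hmδ)
    have h1 := hw1 j
    have h2 := hw2 j
    have h3 := hv j
    rw [Subtype.dist_eq, Real.dist_eq]
    simp only [p]
    rw [min_eq_left (h2.trans h3), min_eq_left h3.le, ← sub_div, abs_div, abs_of_pos hm0]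
    gcongr
    rw [abs_le]
    have h1' : (v j : ℝ) ≤ w j := by exact_mod_cast h1
    have h2' : (w j : ℝ) ≤ v j + 1 := by exact_mod_cast h2
    constructor <;> linarith
  have hSpos : 0 < S.card := hS.2.1.card_pos
  have hSlt : S.card - 1 < Fintype.card ι := by have := hS.2.2; omega
  set i := e.symm ⟨S.card - 1, hSlt⟩ with hi
  have hScard : S.card = (e i : ℕ) + 1 := by
    rw [hi, Equiv.apply_symm_apply]; simp only; omega
  -- `f i` is constant on the cell of `v`
  by_cases hmeet : ∃ y ∈ deepSet 𝒱 S, y i = 0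
  · obtain ⟨w, hw1, hw2, hne⟩ := hcell i 0
    refine hne (if_pos (Or.inr ⟨S, hS, hScard, hmem w hw1 hw2, hmeet⟩))
  · obtain ⟨w, hw1, hw2, hne⟩ := hcell i 1
    refine hne (if_neg ?_)
    rintro (h | ⟨S', hS', hcard, hx, hy⟩)
    · exact hmeet ⟨p w, hmem w hw1 hw2, h⟩
    · have := eq_of_mem_deepSet hS.1 hS'.1 (hScard.trans hcard.symm) (hmem w hw1 hw2) hx
      subst this
      exact hmeet hy

end LebesgueCovering

section CoverDimension

lemma card_le_coverOrd {Y : Type*} {𝒱 : Finset (Set Y)} {n : ℕ} (y : Y)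
    (h : n < (𝒱.filter fun V => y ∈ V).card) : ((n : ℝ) : EReal) ≤ coverOrd 𝒱 := by
  have h1 : ((n + 1 : ℝ) : EReal) ≤
      ⨆ y : Y, (((𝒱.filter fun U => y ∈ U).card : ℝ) : EReal) :=
    le_trans (EReal.coe_le_coe_iff.2 (by exact_mod_cast h))
      (le_iSup (fun y : Y => (((𝒱.filter fun U => y ∈ U).card : ℝ) : EReal)) y)
  refine le_trans (le_of_eq ?_) (EReal.sub_le_sub h1 le_rfl)
  rw [← EReal.coe_one, ← EReal.coe_sub]
  simp

/-- A continuous map from a cube which sends opposite faces to sets not met by a common member of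
`𝒰` bounds `D(𝒰)` from below by the dimension of the cube. -/
lemma card_le_coverD {Y : Type*} [TopologicalSpace Y] {ι : Type*} [Fintype ι]
    (𝒰 : Finset (Set Y)) (Φ : (ι → unitInterval) → Y) (hΦ : Continuous Φ)
    (hface : ∀ U ∈ 𝒰, ∀ i, (∀ x, Φ x ∈ U → x i ≠ 0) ∨ (∀ x, Φ x ∈ U → x i ≠ 1)) :
    ((Fintype.card ι : ℝ) : EReal) ≤ coverD 𝒰 := by
  refine le_iInf₂ fun 𝒱 h𝒱 => ?_
  obtain ⟨⟨ho, hcov⟩, href⟩ := h𝒱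
  obtain ⟨x, hx⟩ := exists_card_lt_card_filter_mem (𝒱.image fun V => Φ ⁻¹' V)
    (by
      intro W hW
      obtain ⟨V, hV, rfl⟩ := Finset.mem_image.1 hW
      exact (ho V hV).preimage hΦ)
    (by
      intro x
      have : Φ x ∈ ⋃ V ∈ 𝒱, V := hcov ▸ Set.mem_univ _
      obtain ⟨V, hV, hxV⟩ := Set.mem_iUnion₂.1 this
      exact ⟨_, Finset.mem_image_of_mem _ hV, hxV⟩)
    (by
      intro W hW i
      obtain ⟨V, hV, rfl⟩ := Finset.mem_image.1 hW
      obtain ⟨U, hU, hVU⟩ := href V hV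
      exact (hface U hU i).imp (fun h x hx => h x (hVU hx)) (fun h x hx => h x (hVU hx)))
  refine card_le_coverOrd (Φ x) (hx.trans_le ?_)
  rw [Finset.filter_image]
  exact Finset.card_image_le

lemma card_le_coverDMap {G Y : Type*} [Group G] [TopologicalSpace Y] [MulAction G Y]
    (𝒰 : Finset (Set Y)) (ρ : ContPseudoMetric Y) (F : Finset G) (δ : ℝ) {d : ℕ}
    (σ : G → Equiv.Perm (Fin d)) (J : Finset (Fin d)) (Φ : (J → unitInterval) → Fin d → Y)
    (hΦ : Continuous Φ) (hmap : ∀ x, Φ x ∈ MapSpace ρ F δ σ)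
    (hface : ∀ U ∈ 𝒰, ∀ a : J, (∀ x, Φ x a ∈ U → x a ≠ 0) ∨ (∀ x, Φ x a ∈ U → x a ≠ 1)) :
    ((J.card : ℝ) : EReal) ≤ coverDMap 𝒰 ρ F δ σ := by
  rw [← Fintype.card_coe]
  refine card_le_coverD _ (fun x => ⟨Φ x, hmap x⟩) (hΦ.subtype_mk hmap) ?_
  intro W hW a
  obtain ⟨W', hW', rfl⟩ := Finset.mem_image.1 hW
  obtain ⟨U, hU, rfl⟩ := Finset.mem_image.1 hW'
  exact (hface (U a) (Fintype.mem_piFinset.1 hU a) a).imp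
    (fun h x hx => h x (hx a)) (fun h x hx => h x (hx a))

end CoverDimension

section FiniteDetermination

variable {G Z Y : Type*} [TopologicalSpace Z] [CompactSpace Z] [T2Space Z] [TopologicalSpace Y]

/-- Up to `ε`, a continuous function on `Z^G` is determined by finitely many coordinates. -/
lemma exists_finset_forall_dist_lt (π : (G → Z) → Y) (hc : Continuous π) (ρ : ContPseudoMetric Y)
    {ε : ℝ} (hε : 0 < ε) :
    ∃ K : Finset G, ∀ u u' : G → Z, (∀ t ∈ K, u t = u' t) → ρ.d (π u) (π u') < ε := by
  let V : Finset G → Set ((G → Z) × (G → Z)) := fun K => {p | ∀ t ∈ K, p.1 t = p.2 t}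
  have hV : ∀ K, IsClosed (V K) := by
    intro K
    have : V K = ⋂ t ∈ K, {p | p.1 t = p.2 t} := by ext; simp [V]
    rw [this]
    exact isClosed_biInter fun t _ => isClosed_eq (by fun_prop) (by fun_prop)
  have hdir : Directed (· ⊇ ·) V := by
    intro K L
    exact ⟨K ∪ L, fun p hp t ht => hp t (Finset.mem_union_left _ ht),
      fun p hp t ht => hp t (Finset.mem_union_right _ ht)⟩
  have hO : IsOpen {p : (G → Z) × (G → Z) | ρ.d (π p.1) (π p.2) < ε} :=
    isOpen_lt (ρ.continuous'.comp (by fun_prop :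
      Continuous fun p : (G → Z) × (G → Z) => (π p.1, π p.2))) continuous_const
  obtain ⟨K, hK⟩ := exists_subset_nhds_of_isCompact' hdir (fun K => (hV K).isCompact) hV
    (U := {p | ρ.d (π p.1) (π p.2) < ε}) (by
      intro p hp
      refine hO.mem_nhds ?_
      have : p.1 = p.2 := funext fun t => Set.mem_iInter.1 hp {t} t (by simp)
      simpa [this, ρ.refl] using hε)
  exact ⟨K, fun u u' h => hK (show (u, u') ∈ V K from h)⟩

/-- A nonconstant continuous function on `Z^G` depends on some coordinate. -/
lemma exists_update_ne (π : (G → Z) → Y) (hc : Continuous π) (ρ : ContPseudoMetric Y)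
    (hρ : ρ.IsCompatMetric) {x x' : G → Z} (hne : π x ≠ π x') :
    ∃ (u : G → Z) (g : G) (z : Z), π u ≠ π (Function.update u g z) := by
  by_contra! hcon
  have hpos : 0 < ρ.d (π x) (π x') := (ρ.nonneg _ _).lt_of_ne fun h => hne (hρ _ _ h.symm)
  obtain ⟨K, hK⟩ := exists_finset_forall_dist_lt π hc ρ hpos
  have hpw : ∀ S : Finset G, π (S.piecewise x' x) = π x := by
    intro S
    induction S using Finset.induction with
    | empty => simp
    | insert a S _ ih => rw [Finset.piecewise_insert, ← hcon, ih]
  have := hK (K.piecewise x' x) x' fun t ht => by simp [ht]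
  rw [hpw] at this
  exact lt_irrefl _ this

lemma exists_update_one_ne [Group G] [MulAction G Y] (π : (G → Z) → Y) (hc : Continuous π)
    (he : Equivariant G π) (ρ : ContPseudoMetric Y) (hρ : ρ.IsCompatMetric) {x x' : G → Z}
    (hne : π x ≠ π x') : ∃ (u : G → Z) (z : Z), π u ≠ π (Function.update u 1 z) := by
  obtain ⟨u, g, z, h⟩ := exists_update_ne π hc ρ hρ hne
  refine ⟨g⁻¹ • u, z, fun heq => h ?_⟩
  have hup : Function.update (g⁻¹ • u) 1 z = g⁻¹ • Function.update u g z := by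
    funext t
    change _ = Function.update u g z (g⁻¹⁻¹ * t)
    by_cases ht : t = 1
    · subst ht; simp
    · have : g * t ≠ g := by simpa using ht
      simp only [ne_eq, ht, not_false_eq_true, Function.update_of_ne, inv_inv, this]
      change u (g⁻¹⁻¹ * t) = _
      rw [inv_inv]
  rw [hup, he, he] at heq
  exact MulAction.injective g⁻¹ heq

end FiniteDetermination

section SoficCounting

/-- A set of points of `B`, proportionally large, whose `K`-orbits are pairwise disjoint. -/
lemma exists_disjoint_orbits {G : Type*} {d : ℕ} (σ : G → Equiv.Perm (Fin d)) (K : Finset G)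
    (B : Finset (Fin d)) (hB : ∀ a ∈ B, ∀ s ∈ K, ∀ t ∈ K, σ s a = σ t a → s = t)
    (hK : K.Nonempty) :
    ∃ J ⊆ B, B.card ≤ J.card * K.card ^ 2 ∧ ∀ a ∈ J, ∀ b ∈ J, ∀ s ∈ K, ∀ t ∈ K,
      σ s a = σ t b → a = b ∧ s = t := by
  let P : Finset (Fin d) → Prop := fun J => ∀ a ∈ J, ∀ b ∈ J, ∀ s ∈ K, ∀ t ∈ K,
      σ s a = σ t b → a = b
  obtain ⟨J, hJ, hmax⟩ := Finset.exists_max_image (B.powerset.filter P) Finset.card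
    ⟨∅, by simp [P]⟩
  rw [Finset.mem_filter, Finset.mem_powerset] at hJ
  refine ⟨J, hJ.1, ?_, ?_⟩
  · have hsub : B ⊆ (J ×ˢ (K ×ˢ K)).image fun p => (σ p.2.2).symm (σ p.2.1 p.1) := by
      intro b hb
      by_contra hcon
      have hcon' : ∀ a ∈ J, ∀ s ∈ K, ∀ t ∈ K, σ s a ≠ σ t b := by
        intro a ha s hs t ht h
        refine hcon (Finset.mem_image.2 ⟨(a, s, t), by simp [ha, hs, ht], ?_⟩)
        simp [h]
      obtain ⟨k, hk⟩ := hK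
      have hbJ : b ∉ J := fun h => hcon' b h k hk k hk rfl
      have := hmax (insert b J) (by
        rw [Finset.mem_filter, Finset.mem_powerset]
        refine ⟨Finset.insert_subset hb hJ.1, fun a ha c hc s hs t ht h => ?_⟩
        rcases Finset.mem_insert.1 ha with rfl | ha' <;>
          rcases Finset.mem_insert.1 hc with rfl | hc'
        · rfl
        · exact absurd h.symm (hcon' c hc' t ht s hs)
        · exact absurd h (hcon' a ha' s hs t ht)
        · exact hJ.2 a ha' c hc' s hs t ht h)
      rw [Finset.card_insert_of_notMem hbJ] at this
      omega
    refine (Finset.card_le_card hsub).trans (Finset.card_image_le.trans ?_)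
    rw [Finset.card_product, Finset.card_product, sq]
  · intro a ha b hb s hs t ht h
    obtain rfl := hJ.2 a ha b hb s hs t ht h
    exact ⟨rfl, hB a (hJ.1 ha) s hs t ht h⟩

variable {G : Type*} [Group G]

lemma tendsto_card_sep_fail (Sap : SoficApprox G) (K : Finset G) :
    Tendsto (fun i => ((Finset.univ.filter fun a : Fin (Sap.d i) =>
      ∃ s ∈ K, ∃ t ∈ K, s ≠ t ∧ Sap.σ i s a = Sap.σ i t a).card : ℝ) / (Sap.d i : ℝ))
      atTop (𝓝 0) := by
  have hlim : Tendsto (fun i => ∑ p ∈ K.offDiag, ((Finset.univ.filter fun a : Fin (Sap.d i) =>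
      Sap.σ i p.1 a = Sap.σ i p.2 a).card : ℝ) / (Sap.d i : ℝ)) atTop (𝓝 0) := by
    rw [← Finset.sum_const_zero (s := K.offDiag) (M := ℝ)]
    exact tendsto_finsetSum _ fun p hp => Sap.approx_sep _ _ (Finset.mem_offDiag.1 hp).2.2
  refine squeeze_zero (fun i => by positivity) (fun i => ?_) hlim
  rw [← Finset.sum_div]
  gcongr
  rw [← Nat.cast_sum]
  refine Nat.cast_le.2 (le_trans (Finset.card_le_card ?_) Finset.card_biUnion_le)
  intro a ha
  obtain ⟨s, hs, t, ht, hst, h⟩ := (Finset.mem_filter.1 ha).2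
  exact Finset.mem_biUnion.2 ⟨(s, t), Finset.mem_offDiag.2 ⟨hs, ht, hst⟩, by simpa using h⟩

lemma tendsto_card_mul_fail (Sap : SoficApprox G) (L F : Finset G) :
    Tendsto (fun i => ((Finset.univ.filter fun a : Fin (Sap.d i) =>
      ∃ s ∈ L, ∃ t ∈ F, Sap.σ i s (Sap.σ i t a) ≠ Sap.σ i (s * t) a).card : ℝ) / (Sap.d i : ℝ))
      atTop (𝓝 0) := by
  have hlim : Tendsto (fun i => ∑ p ∈ L ×ˢ F, (1 - ((Finset.univ.filter fun a : Fin (Sap.d i) =>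
      Sap.σ i p.1 (Sap.σ i p.2 a) = Sap.σ i (p.1 * p.2) a).card : ℝ) / (Sap.d i : ℝ)))
      atTop (𝓝 0) := by
    rw [← Finset.sum_const_zero (s := L ×ˢ F) (M := ℝ)]
    refine tendsto_finsetSum _ fun p _ => ?_
    simpa using tendsto_const_nhds.sub (Sap.approx_mul p.1 p.2) (a := (1 : ℝ))
  refine squeeze_zero' (Eventually.of_forall fun i => by positivity) ?_ hlim
  filter_upwards [Sap.d_tendsto.eventually_ge_atTop 1] with i hi
  have hd : (0 : ℝ) < Sap.d i := by exact_mod_cast hi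
  have hterm : ∀ p : G × G, 1 - ((Finset.univ.filter fun a : Fin (Sap.d i) =>
      Sap.σ i p.1 (Sap.σ i p.2 a) = Sap.σ i (p.1 * p.2) a).card : ℝ) / (Sap.d i : ℝ) =
      ((Finset.univ.filter fun a : Fin (Sap.d i) =>
      Sap.σ i p.1 (Sap.σ i p.2 a) ≠ Sap.σ i (p.1 * p.2) a).card : ℝ) / (Sap.d i : ℝ) := by
    intro p
    have := Finset.card_filter_add_card_filter_not (s := Finset.univ) (fun a : Fin (Sap.d i) =>
      Sap.σ i p.1 (Sap.σ i p.2 a) = Sap.σ i (p.1 * p.2) a)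
    rw [Finset.card_univ, Fintype.card_fin] at this
    rw [eq_div_iff hd.ne', sub_mul, div_mul_cancel₀ _ hd.ne', one_mul, sub_eq_iff_eq_add']
    exact_mod_cast this.symm
  simp_rw [hterm]
  rw [← Finset.sum_div]
  gcongr
  rw [← Nat.cast_sum]
  refine Nat.cast_le.2 (le_trans (Finset.card_le_card ?_) Finset.card_biUnion_le)
  intro a ha
  obtain ⟨s, hs, t, ht, h⟩ := (Finset.mem_filter.1 ha).2
  exact Finset.mem_biUnion.2 ⟨(s, t), Finset.mem_product.2 ⟨hs, ht⟩, by simpa using h⟩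

end SoficCounting

section OrbitMaps

variable {G : Type*} [Group G] {Z : Type*} [TopologicalSpace Z]
  {Y : Type*} [TopologicalSpace Y]

/-- The map `[d] → Y` obtained by applying `π` to the points of `Z^G` read off from a
`Z`-labelling `w` of `[d]` along the maps `σ`. -/
def orbitMap (π : (G → Z) → Y) {d : ℕ} (σ : G → Equiv.Perm (Fin d)) (w : Fin d → Z) : Fin d → Y :=
  fun a => π fun t => w (σ t⁻¹ a)

lemma eventually_orbitMap_mem_mapSpace (Sap : SoficApprox G) [CompactSpace Z] [T2Space Z]
    [CompactSpace Y] [MulAction G Y] (π : (G → Z) → Y) (hc : Continuous π) (he : Equivariant G π)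
    (ρ : ContPseudoMetric Y) (F : Finset G) {δ : ℝ} (hδ : 0 < δ) :
    ∀ᶠ i in atTop, ∀ w : Fin (Sap.d i) → Z,
      orbitMap π (Sap.σ i) w ∈ MapSpace ρ F δ (Sap.σ i) := by
  obtain ⟨M, hM⟩ : ∃ M, ∀ y y', ρ.d y y' ≤ M := by
    obtain ⟨M, hM⟩ := (isCompact_range ρ.continuous').bddAbove
    exact ⟨M, fun y y' => hM ⟨(y, y'), rfl⟩⟩
  obtain ⟨L, hL⟩ := exists_finset_forall_dist_lt π hc ρ (half_pos hδ)
  have hη : 0 < δ ^ 2 / (2 * (M ^ 2 + 1)) := by positivity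
  filter_upwards [(tendsto_card_mul_fail Sap L⁻¹ F).eventually_lt_const hη,
    Sap.d_tendsto.eventually_ge_atTop 1] with i hi hd w s hs
  have hd : (0 : ℝ) < Sap.d i := by exact_mod_cast hd
  set bad := Finset.univ.filter fun a : Fin (Sap.d i) =>
      ∃ s ∈ L⁻¹, ∃ t ∈ F, Sap.σ i s (Sap.σ i t a) ≠ Sap.σ i (s * t) a with hbad
  have hterm : ∀ a, ρ.d (orbitMap π (Sap.σ i) w (Sap.σ i s a)) (s • orbitMap π (Sap.σ i) w a) ^ 2 ≤
      (δ / 2) ^ 2 + if a ∈ bad then M ^ 2 else 0 := by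
    intro a
    split_ifs with ha
    · have := pow_le_pow_left₀ (ρ.nonneg _ _) (hM (orbitMap π (Sap.σ i) w (Sap.σ i s a))
        (s • orbitMap π (Sap.σ i) w a)) 2
      nlinarith [sq_nonneg (δ / 2)]
    · rw [add_zero]
      refine pow_le_pow_left₀ (ρ.nonneg _ _) ?_ 2
      simp only [orbitMap, ← he s]
      refine (hL _ _ fun t ht => ?_).le
      change w _ = w (Sap.σ i (s⁻¹ * t)⁻¹ a)
      rw [mul_inv_rev, inv_inv]
      simp only [hbad, Finset.mem_filter, Finset.mem_univ, true_and, not_exists, not_and,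
        not_not] at ha
      rw [ha t⁻¹ (Finset.inv_mem_inv ht) s hs]
  refine Real.sqrt_le_iff.2 ⟨hδ.le, ?_⟩
  have hsum := Finset.sum_le_sum fun a (_ : a ∈ Finset.univ) => hterm a
  rw [Finset.sum_add_distrib, Finset.sum_const, Finset.card_univ, Fintype.card_fin,
    ← Finset.sum_filter, Finset.sum_const, Finset.filter_univ_mem, nsmul_eq_mul,
    nsmul_eq_mul] at hsum
  rw [one_div, inv_mul_le_iff₀ hd]
  rw [div_lt_iff₀ hd, div_mul_eq_mul_div, lt_div_iff₀ (by positivity)] at hi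
  have hcard : (0 : ℝ) ≤ bad.card := by positivity
  nlinarith [mul_pos hd (pow_pos hδ 2)]

/-- Labellings of `[d]`, parametrized by a cube, that along the `K`-orbit of each `a ∈ J` show
`u` with the coordinate at the identity moved along the path `γ`. -/
lemma exists_cube_labelling {d : ℕ} (σ : G → Equiv.Perm (Fin d)) (K : Finset G) (hK : 1 ∈ K)
    (J : Finset (Fin d)) (hJ : ∀ a ∈ J, ∀ b ∈ J, ∀ s ∈ K, ∀ t ∈ K,
      σ s⁻¹ a = σ t⁻¹ b → a = b ∧ s = t) (u : G → Z) {z : Z} (γ : Path (u 1) z) :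
    ∃ w : (J → unitInterval) → Fin d → Z, Continuous w ∧
      ∀ θ, ∀ a : J, ∀ t ∈ K, w θ (σ t⁻¹ a) = Function.update u 1 (γ (θ a)) t := by
  refine ⟨fun θ b => if h : ∃ a : J, σ 1⁻¹ a = b then γ (θ h.choose) else
    if h : ∃ p : J × K, σ (p.2 : G)⁻¹ p.1 = b then u h.choose.2 else u 1, ?_, ?_⟩
  · refine continuous_pi fun b => ?_
    split_ifs <;> fun_prop
  · intro θ a t ht
    by_cases ht1 : t = 1
    · subst ht1
      have h : ∃ a' : J, σ 1⁻¹ a' = σ 1⁻¹ a := ⟨a, rfl⟩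
      have ha : h.choose = a :=
        Subtype.ext (hJ _ h.choose.2 _ a.2 1 hK 1 hK h.choose_spec).1
      simp only [dif_pos h, ha, Function.update_self]
    · have h1 : ¬ ∃ a' : J, σ 1⁻¹ a' = σ t⁻¹ a := fun ⟨a', h⟩ =>
        ht1 (hJ _ a'.2 _ a.2 1 hK t ht h).2.symm
      have h2 : ∃ p : J × K, σ (p.2 : G)⁻¹ p.1 = σ t⁻¹ a := ⟨(a, ⟨t, ht⟩), rfl⟩
      have ht' : (h2.choose.2 : G) = t :=
        (hJ _ h2.choose.1.2 _ a.2 _ h2.choose.2.2 t ht h2.choose_spec).2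
      simp only [dif_neg h1, dif_pos h2, ht', Function.update_of_ne ht1]

/-- If the images under `π` of the ends of a path in one coordinate are far apart, then the
approximately equivariant maps contain cubes of dimension proportional to `d i`. -/
lemma eventually_le_coverDMap (Sap : SoficApprox G) [CompactSpace Z] [T2Space Z]
    [CompactSpace Y] [MulAction G Y] (π : (G → Z) → Y) (hc : Continuous π) (he : Equivariant G π)
    (ρ : ContPseudoMetric Y) {ε : ℝ} (K : Finset G) (h1K : 1 ∈ K)
    (hK : ∀ u u' : G → Z, (∀ t ∈ K, u t = u' t) → ρ.d (π u) (π u') < ε)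
    (u : G → Z) {z : Z} (γ : Path (u 1) z) (F : Finset G) {δ : ℝ} (hδ : 0 < δ) :
    ∀ᶠ i in atTop, (((Sap.d i : ℝ) / (2 * (K.card : ℝ) ^ 2) : ℝ) : EReal) ≤
      coverDMap {{y | ε < ρ.d y (π u)}, {y | ε < ρ.d y (π (Function.update u 1 z))}}
        ρ F δ (Sap.σ i) := by
  have hKpos : (0 : ℝ) < K.card := by exact_mod_cast Finset.card_pos.2 ⟨1, h1K⟩
  filter_upwards [eventually_orbitMap_mem_mapSpace Sap π hc he ρ F hδ,
    (tendsto_card_sep_fail Sap K⁻¹).eventually_lt_const (one_half_pos (α := ℝ)),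
    Sap.d_tendsto.eventually_ge_atTop 1] with i hmap hsep hd
  have hd : (0 : ℝ) < Sap.d i := by exact_mod_cast hd
  set B := Finset.univ.filter fun a : Fin (Sap.d i) =>
    ¬ ∃ s ∈ K⁻¹, ∃ t ∈ K⁻¹, s ≠ t ∧ Sap.σ i s a = Sap.σ i t a with hB
  obtain ⟨J, -, hcard, hJ⟩ := exists_disjoint_orbits (fun t => Sap.σ i t⁻¹) K B (by
    intro a ha s hs t ht h
    by_contra hst
    exact (Finset.mem_filter.1 ha).2 ⟨s⁻¹, Finset.inv_mem_inv hs, t⁻¹, Finset.inv_mem_inv ht,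
      fun h => hst (inv_injective h), h⟩) ⟨1, h1K⟩
  have hJcard : (Sap.d i : ℝ) / (2 * (K.card : ℝ) ^ 2) ≤ J.card := by
    have hsplit := Finset.card_filter_add_card_filter_not (s := Finset.univ)
      (fun a : Fin (Sap.d i) => ∃ s ∈ K⁻¹, ∃ t ∈ K⁻¹, s ≠ t ∧ Sap.σ i s a = Sap.σ i t a)
    rw [Finset.card_univ, Fintype.card_fin, ← hB] at hsplit
    have hsplit' : (_ : ℝ) = Sap.d i := congrArg (Nat.cast (R := ℝ)) hsplit
    have hcard' : (B.card : ℝ) ≤ J.card * (K.card : ℝ) ^ 2 := by exact_mod_cast hcard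
    rw [div_lt_iff₀ hd] at hsep
    push_cast at hsplit'
    rw [div_le_iff₀ (by positivity)]
    linarith
  obtain ⟨w, hwc, hw⟩ := exists_cube_labelling (Sap.σ i) K h1K J hJ u γ
  refine (EReal.coe_le_coe_iff.2 hJcard).trans
    (card_le_coverDMap _ ρ F δ (Sap.σ i) J (fun θ => orbitMap π (Sap.σ i) (w θ)) ?_
      (fun θ => hmap _) ?_)
  · exact continuous_pi fun a => hc.comp (continuous_pi fun t => (continuous_apply _).comp hwc)
  · have hnear : ∀ (θ : J → unitInterval) (a : J),
        ρ.d (orbitMap π (Sap.σ i) (w θ) a) (π (Function.update u 1 (γ (θ a)))) < ε :=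
      fun θ a => hK _ _ fun t ht => hw θ a t ht
    intro U hU a
    rcases Finset.mem_insert.1 hU with rfl | hU
    · refine Or.inl fun θ (hθ : ε < ρ.d _ _) h => lt_asymm hθ ?_
      simpa [h] using hnear θ a
    · obtain rfl := Finset.mem_singleton.1 hU
      refine Or.inr fun θ (hθ : ε < ρ.d _ _) h => lt_asymm hθ ?_
      simpa [h] using hnear θ a

end OrbitMaps

/-- For the left shift action of a countable sofic group `G` on `X = Z^G` with `Z`
a path-connected compact metrizable space, every nontrivial factor `Y` of `X` has
`mdim_Σ(Y) > 0`. -/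
theorem mdimSigma_factor_pos {G : Type*} [Group G] [Countable G] (Sap : SoficApprox G)
    (Z : Type*) [TopologicalSpace Z] [CompactSpace Z] [MetrizableSpace Z]
    [PathConnectedSpace Z]
    {Y : Type*} [TopologicalSpace Y] [CompactSpace Y] [MetrizableSpace Y] [Nontrivial Y]
    [MulAction G Y] [ContinuousConstSMul G Y]
    (π : (G → Z) → Y) (hc : Continuous π) (hs : Function.Surjective π)
    (he : Equivariant G π)
    (ρY : ContPseudoMetric Y) (hρY : ρY.IsCompatMetric) :
    0 < mdimSigma Sap ρY := by
  obtain ⟨y, y', hyy⟩ := exists_pair_ne Y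
  obtain ⟨x, rfl⟩ := hs y
  obtain ⟨x', rfl⟩ := hs y'
  obtain ⟨u, z, hne⟩ := exists_update_one_ne π hc he ρY hρY hyy
  set y₀ := π u
  set y₁ := π (Function.update u 1 z)
  have hpos : 0 < ρY.d y₀ y₁ := (ρY.nonneg _ _).lt_of_ne fun h => hne (hρY _ _ h.symm)
  set ε := ρY.d y₀ y₁ / 3 with hε
  obtain ⟨K₀, hK₀⟩ := exists_finset_forall_dist_lt π hc ρY (ε := ε) (by positivity)
  set K := insert 1 K₀
  have hK : ∀ u u' : G → Z, (∀ t ∈ K, u t = u' t) → ρY.d (π u) (π u') < ε :=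
    fun u u' h => hK₀ u u' fun t ht => h t (Finset.mem_insert_of_mem ht)
  have h1K : (1 : G) ∈ K := Finset.mem_insert_self _ _
  have hKpos : (0 : ℝ) < K.card := by exact_mod_cast Finset.card_pos.2 ⟨1, h1K⟩
  have hcover : IsFinOpenCover ({{y | ε < ρY.d y y₀}, {y | ε < ρY.d y y₁}} : Finset (Set Y)) := by
    have hopen : ∀ c, IsOpen {y | ε < ρY.d y c} := fun c =>
      isOpen_lt continuous_const (ρY.continuous'.comp (Continuous.prodMk_left c))
    refine ⟨?_, Set.eq_univ_of_forall fun y => ?_⟩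
    · intro U hU
      rcases Finset.mem_insert.1 hU with rfl | hU
      · exact hopen _
      · exact Finset.mem_singleton.1 hU ▸ hopen _
    · simp only [Finset.mem_insert, Finset.mem_singleton, Set.iUnion_iUnion_eq_or_left,
        Set.iUnion_iUnion_eq_left, Set.mem_union, Set.mem_ofPred_eq]
      by_contra! hcon
      have := ρY.triangle y₀ y y₁
      rw [ρY.symm y₀ y] at this
      linarith [hcon.1, hcon.2]
  have hlt : (0 : EReal) < ((1 / (2 * (K.card : ℝ) ^ 2) : ℝ) : EReal) :=
    EReal.coe_pos.2 (by positivity)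
  refine hlt.trans_le (le_trans ?_ (le_iSup₂ (f := fun 𝒰
    (_ : 𝒰 ∈ {𝒰 : Finset (Set Y) | IsFinOpenCover 𝒰}) => DSigmaU Sap 𝒰 ρY) _ hcover))
  refine le_iInf fun F => le_iInf fun δ => ?_
  refine le_limsup_of_frequently_le (Eventually.frequently ?_)
  filter_upwards [eventually_le_coverDMap Sap π hc he ρY K h1K hK u
    (PathConnectedSpace.somePath (u 1) z) F.1 δ.2, Sap.d_tendsto.eventually_ge_atTop 1] with i hi hd
  have hd : (0 : ℝ) < Sap.d i := by exact_mod_cast hd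
  refine le_trans (le_of_eq ?_) (mul_le_mul_of_nonneg_right hi ?_)
  · rw [← EReal.coe_inv, ← EReal.coe_mul]
    congr 1
    field_simp
  · rw [← EReal.coe_inv]
    exact EReal.coe_nonneg.2 (by positivity)

end SoficMD
end

section
/- Let a countable sofic group G act continuously on a compact metrizable space X, let Σ be a sofic approximation sequence for G, and suppose the action has the small-boundary property. Then mdim_Σ(X) ≤ 0. -/
open Filter Topology TopologicalSpace
open scoped ENat
open scoped Classical Pointwise

open Filter Topology TopologicalSpace MeasureTheory
open scoped ENat
open scoped Classical Pointwise

namespace SoficMD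

/-- A closed subset is small if it is null for every `G`-invariant Borel probability measure. -/
def IsSmallSet (G : Type*) {X : Type*} [Group G] [TopologicalSpace X] [MeasurableSpace X]
    [MulAction G X] (Z : Set X) : Prop :=
  ∀ μ : Measure X, IsProbabilityMeasure μ →
    (∀ s : G, Measure.map (fun x => s • x) μ = μ) → μ Z = 0

section FreudenthalStar

variable {ι : Type*}

/-- The open star of the vertex `v` in the Freudenthal triangulation of `ι → ℝ`. -/
def freudenthalStar (v : ι → ℤ) : Set (ι → ℝ) :=
  {x | (∀ i, |x i - v i| < 1) ∧ ∀ i j, (x i - v i) - (x j - v j) < 1}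

theorem isOpen_freudenthalStar [Finite ι] (v : ι → ℤ) : IsOpen (freudenthalStar v) := by
  unfold freudenthalStar
  simp only [Set.ofPred_and, Set.ofPred_forall]
  refine IsOpen.inter (isOpen_iInter_of_finite fun i => ?_)
    (isOpen_iInter_of_finite fun i => isOpen_iInter_of_finite fun j => ?_)
  · exact isOpen_lt (by fun_prop) continuous_const
  · exact isOpen_lt (by fun_prop) continuous_const

theorem mem_freudenthalStar_ceil (x : ι → ℝ) : x ∈ freudenthalStar fun i => ⌈x i⌉ := by
  refine ⟨fun i => ?_, fun i j => ?_⟩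
  · rw [abs_lt]
    constructor <;> linarith [Int.le_ceil (x i), Int.ceil_lt_add_one (x i)]
  · linarith [Int.le_ceil (x i), Int.ceil_lt_add_one (x j)]

theorem ceil_sub_floor_le_ite (x : ℝ) :
    ⌈x⌉ - ⌊x⌋ ≤ if ∀ n : ℤ, x ≠ n then 1 else 0 := by
  split_ifs with h
  · linarith [Int.ceil_le_floor_add_one x]
  · push Not at h
    obtain ⟨n, rfl⟩ := h
    simp

/-- The number of Freudenthal stars containing a point is at most one more than the number of
its non-integral coordinates. -/
theorem card_freudenthalStar_le [Fintype ι] (T : Finset (ι → ℤ)) (x : ι → ℝ) :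
    (T.filter fun v => x ∈ freudenthalStar v).card ≤
      (Finset.univ.filter fun i => ∀ n : ℤ, x i ≠ n).card + 1 := by
  have hfl : ∀ v : ι → ℤ, x ∈ freudenthalStar v → ∀ i, ⌊x i⌋ ≤ v i ∧ v i ≤ ⌈x i⌉ := by
    intro v hv i
    have := abs_lt.1 (hv.1 i)
    rw [Int.floor_le_iff, Int.le_ceil_iff]
    constructor <;> linarith
  have hchain : ∀ v w : ι → ℤ, x ∈ freudenthalStar v → x ∈ freudenthalStar w →
      ∀ i j, v i < w i → ¬ w j < v j := by
    intro v w hv hw i j hi hj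
    have h1 := hv.2 i j
    have h2 := hw.2 j i
    have h3 : (v i : ℝ) + 1 ≤ w i := by exact_mod_cast hi
    have h4 : (w j : ℝ) + 1 ≤ v j := by exact_mod_cast hj
    linarith
  have hcard : (T.filter fun v => x ∈ freudenthalStar v).card ≤
      (Finset.Icc (∑ i, ⌊x i⌋) (∑ i, ⌈x i⌉)).card := by
    refine Finset.card_le_card_of_injOn (fun v => ∑ i, v i) ?_ ?_
    · intro v hv
      have hv' := hfl v (Finset.mem_filter.1 hv).2
      simp only [Finset.coe_Icc, Set.mem_Icc]
      exact ⟨Finset.sum_le_sum fun i _ => (hv' i).1, Finset.sum_le_sum fun i _ => (hv' i).2⟩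
    · intro v hv w hw hvw
      have hv' := (Finset.mem_filter.1 hv).2
      have hw' := (Finset.mem_filter.1 hw).2
      have hvw' : ∑ i, v i = ∑ i, w i := hvw
      by_cases hle : ∀ i, v i ≤ w i
      · funext i
        exact (Finset.sum_eq_sum_iff_of_le fun i _ => hle i).1 hvw' i (Finset.mem_univ i)
      · push Not at hle
        obtain ⟨j, hj⟩ := hle
        have hle' : ∀ i, w i ≤ v i := fun i => not_lt.1 fun hi => hchain v w hv' hw' i j hi hj
        funext i
        exact ((Finset.sum_eq_sum_iff_of_le fun i _ => hle' i).1 hvw'.symm i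
          (Finset.mem_univ i)).symm
  refine hcard.trans ?_
  rw [Int.card_Icc]
  have : ∑ i, ⌈x i⌉ - ∑ i, ⌊x i⌋ ≤ ((Finset.univ.filter fun i => ∀ n : ℤ, x i ≠ n).card : ℤ) := by
    rw [← Finset.sum_sub_distrib, Finset.card_filter]
    push_cast
    exact Finset.sum_le_sum fun i _ => ceil_sub_floor_le_ite (x i)
  omega

end FreudenthalStar

/-- A bound for the order of the product cover over a set of maps on which the family `f`
takes few non-integral values. -/
theorem coverD_restrictCover_prodCover_le {X ι : Type*} [TopologicalSpace X] [Fintype ι]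
    (𝒰 : Finset (Set X)) (f : ι → X → ℝ) (hf : ∀ j, Continuous (f j))
    (hf₀ : ∀ j x, 0 ≤ f j x) (hf₁ : ∀ j x, f j x ≤ 1) (hone : ∀ x, ∃ j, f j x = 1)
    (hsupp : ∀ j, ∃ U ∈ 𝒰, ∀ x, 0 < f j x → x ∈ U) {d : ℕ} (Y : Set (Fin d → X)) (R : ℝ)
    (hR : ∀ φ ∈ Y, ((Finset.univ.filter fun p : Fin d × ι =>
      ∀ n : ℤ, f p.2 (φ p.1) ≠ n).card : ℝ) ≤ R) :
    coverD (restrictCover (prodCover 𝒰 d) Y) ≤ (R : EReal) := by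
  set T : Finset (Fin d × ι → ℤ) := Fintype.piFinset fun _ => Finset.Icc 0 1 with hT
  let e : Y → Fin d × ι → ℝ := fun φ p => f p.2 (φ.1 p.1)
  have he : Continuous e := continuous_pi fun p =>
    (hf p.2).comp ((continuous_apply p.1).comp continuous_subtype_val)
  let 𝒱 : Finset (Set Y) :=
    (T.image fun v => e ⁻¹' freudenthalStar v).filter fun V => V.Nonempty
  have hcover : IsFinOpenCover 𝒱 := by
    refine ⟨fun V hV => ?_, Set.eq_univ_of_forall fun φ => ?_⟩
    · obtain ⟨v, -, rfl⟩ := Finset.mem_image.1 (Finset.mem_filter.1 hV).1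
      exact (isOpen_freudenthalStar v).preimage he
    · have hφ := mem_freudenthalStar_ceil (e φ)
      refine Set.mem_biUnion (x := e ⁻¹' freudenthalStar fun p => ⌈e φ p⌉) ?_ hφ
      refine Finset.mem_coe.2 (Finset.mem_filter.2 ⟨Finset.mem_image_of_mem _ ?_, φ, hφ⟩)
      rw [hT, Fintype.mem_piFinset]
      intro p
      exact Finset.mem_Icc.2 ⟨Int.ceil_nonneg (hf₀ _ _),
        Int.ceil_le.2 (by simpa using hf₁ p.2 (φ.1 p.1))⟩
  have hrefines : Refines 𝒱 (restrictCover (prodCover 𝒰 d) Y) := by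
    intro V hV
    obtain ⟨hV, φ, hφ⟩ := Finset.mem_filter.1 hV
    obtain ⟨v, -, rfl⟩ := Finset.mem_image.1 hV
    have hpos : ∀ a : Fin d, ∃ j, 0 < v (a, j) := by
      intro a
      obtain ⟨j, hj⟩ := hone (φ.1 a)
      refine ⟨j, ?_⟩
      have := (abs_lt.1 (hφ.1 (a, j))).2
      have h1 : e φ (a, j) = 1 := hj
      rw [h1] at this
      have : (0 : ℝ) < v (a, j) := by linarith
      exact_mod_cast this
    choose j hj using hpos
    choose U hU hfU using hsupp
    refine ⟨_, Finset.mem_image_of_mem _ (Finset.mem_image_of_mem _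
      (Fintype.mem_piFinset.2 fun a => hU (j a))), fun ψ hψ a => hfU _ _ ?_⟩
    have := (abs_lt.1 (hψ.1 (a, j a))).1
    have h1 : (1 : ℝ) ≤ v (a, j a) := by exact_mod_cast hj a
    change 0 < e ψ (a, j a)
    linarith
  refine (iInf₂_le 𝒱 ⟨hcover, hrefines⟩).trans ?_
  have hsup : (⨆ φ : Y, (((𝒱.filter fun V => φ ∈ V).card : ℝ) : EReal)) ≤
      ((R + 1 : ℝ) : EReal) := by
    refine iSup_le fun φ => EReal.coe_le_coe_iff.2 ?_
    have hsub : (𝒱.filter fun V => φ ∈ V) ⊆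
        (T.filter fun v => e φ ∈ freudenthalStar v).image fun v => e ⁻¹' freudenthalStar v := by
      intro V hV
      obtain ⟨hV, hφ⟩ := Finset.mem_filter.1 hV
      obtain ⟨v, hv, rfl⟩ := Finset.mem_image.1 (Finset.mem_filter.1 hV).1
      exact Finset.mem_image_of_mem _ (Finset.mem_filter.2 ⟨hv, hφ⟩)
    have hle := ((Finset.card_le_card hsub).trans Finset.card_image_le).trans
      (card_freudenthalStar_le T (e φ))
    have hle' : ((𝒱.filter fun V => φ ∈ V).card : ℝ) ≤
        ((Finset.univ.filter fun p : Fin d × ι => ∀ n : ℤ, f p.2 (φ.1 p.1) ≠ n).card : ℝ) + 1 := by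
      exact_mod_cast hle
    linarith [hR φ.1 φ.2]
  calc coverOrd 𝒱 ≤ ((R + 1 : ℝ) : EReal) - 1 := EReal.sub_le_sub hsup le_rfl
    _ = ((R + 1 - 1 : ℝ) : EReal) := by rw [EReal.coe_sub]; rfl
    _ = (R : EReal) := by rw [add_sub_cancel_right]

/-- The normalized counting measure along a map `φ : Fin d → X`. -/
noncomputable def empiricalMeasure {X : Type*} [MeasurableSpace X] {d : ℕ} (φ : Fin d → X) :
    Measure X :=
  (d : ENNReal)⁻¹ • ∑ a, Measure.dirac (φ a)

theorem isProbabilityMeasure_empiricalMeasure {X : Type*} [MeasurableSpace X] {d : ℕ}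
    (hd : d ≠ 0) (φ : Fin d → X) : IsProbabilityMeasure (empiricalMeasure φ) := by
  constructor
  simp only [empiricalMeasure, Measure.smul_apply, Measure.finsetSum_apply, measure_univ,
    Finset.sum_const, Finset.card_univ, Fintype.card_fin, smul_eq_mul, nsmul_eq_mul, mul_one]
  exact ENNReal.inv_mul_cancel (by exact_mod_cast hd) (ENNReal.natCast_ne_top d)

theorem empiricalMeasure_apply {X : Type*} [MeasurableSpace X] {d : ℕ} (φ : Fin d → X)
    {K : Set X} (hK : MeasurableSet K) :
    empiricalMeasure φ K =
      (d : ENNReal)⁻¹ * ((Finset.univ.filter fun a => φ a ∈ K).card : ENNReal) := by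
  simp [empiricalMeasure, Measure.smul_apply, Measure.finsetSum_apply,
    Measure.dirac_apply' _ hK, Set.indicator_apply, Finset.sum_boole]

theorem integral_empiricalMeasure {X : Type*} [TopologicalSpace X] [MeasurableSpace X]
    [BorelSpace X] {d : ℕ} (φ : Fin d → X) {h : X → ℝ} (hh : Continuous h) :
    ∫ x, h x ∂(empiricalMeasure φ) = (d : ℝ)⁻¹ * ∑ a, h (φ a) := by
  have hsm : StronglyMeasurable h := hh.measurable.stronglyMeasurable
  rw [empiricalMeasure, integral_smul_measure, integral_finsetSum_measure]
  · simp [integral_dirac' _ _ hsm]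
  · intro a _
    refine ⟨hsm.aestronglyMeasurable, ?_⟩
    rw [HasFiniteIntegral, lintegral_dirac' _ hsm.enorm]
    exact enorm_lt_top

theorem exists_abs_sub_le_add_mul_sq {X : Type*} [TopologicalSpace X] [CompactSpace X]
    (ρ : ContPseudoMetric X) (hρ : ρ.IsCompatMetric) {h : X → ℝ} (hh : Continuous h)
    {η : ℝ} (hη : 0 < η) :
    ∃ C : ℝ, 0 ≤ C ∧ ∀ x y, |h x - h y| ≤ η + C * ρ.d x y ^ 2 := by
  have hcont : Continuous fun p : X × X => |h p.1 - h p.2| := by fun_prop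
  have hK : IsCompact {p : X × X | η ≤ |h p.1 - h p.2|} :=
    (isClosed_le continuous_const hcont).isCompact
  have hpos : ∀ p ∈ {p : X × X | η ≤ |h p.1 - h p.2|}, 0 < ρ.d p.1 p.2 := by
    intro p hp
    refine lt_of_le_of_ne (ρ.nonneg _ _) fun h0 => ?_
    have := hρ _ _ h0.symm
    rw [Set.mem_ofPred_eq, this, sub_self, abs_zero] at hp
    linarith
  have hquot : ContinuousOn (fun p : X × X => |h p.1 - h p.2| / ρ.d p.1 p.2 ^ 2)
      {p : X × X | η ≤ |h p.1 - h p.2|} :=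
    hcont.continuousOn.div (ρ.continuous'.pow 2).continuousOn
      fun p hp => (pow_pos (hpos p hp) 2).ne'
  obtain ⟨C, hC⟩ := hK.exists_bound_of_continuousOn hquot
  refine ⟨max C 0, le_max_right _ _, fun x y => ?_⟩
  by_cases hxy : η ≤ |h x - h y|
  · have h1 := (Real.le_norm_self _).trans (hC (x, y) hxy)
    have h2 := pow_pos (hpos (x, y) hxy) 2
    rw [div_le_iff₀ h2] at h1
    have h3 : C * ρ.d x y ^ 2 ≤ max C 0 * ρ.d x y ^ 2 := by gcongr; exact le_max_left _ _
    simp only at h1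
    linarith
  · have : 0 ≤ max C 0 * ρ.d x y ^ 2 := by positivity
    linarith

/-- Empirical measures of approximately equivariant maps are approximately invariant. -/
theorem abs_integral_empiricalMeasure_sub_le {G X : Type*} [Group G] [TopologicalSpace X]
    [MeasurableSpace X] [BorelSpace X] [MulAction G X] [ContinuousConstSMul G X]
    (ρ : ContPseudoMetric X) {h : X → ℝ} (hh : Continuous h) {η C : ℝ} (hC : 0 ≤ C)
    (hη : ∀ x y, |h x - h y| ≤ η + C * ρ.d x y ^ 2) {F : Finset G} {δ : ℝ} {d : ℕ} (hd : d ≠ 0)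
    {σ : G → Equiv.Perm (Fin d)} {φ : Fin d → X} (hφ : φ ∈ MapSpace ρ F δ σ) {s : G}
    (hs : s ∈ F) :
    |∫ x, h (s • x) ∂(empiricalMeasure φ) - ∫ x, h x ∂(empiricalMeasure φ)| ≤
      η + C * δ ^ 2 := by
  have hd' : (0 : ℝ) < d := by exact_mod_cast Nat.pos_of_ne_zero hd
  rw [integral_empiricalMeasure φ (h := fun x => h (s • x)) (hh.comp (continuous_const_smul s)),
    integral_empiricalMeasure φ hh, ← Equiv.sum_comp (σ s) fun a => h (φ a), ← mul_sub,
    ← Finset.sum_sub_distrib, abs_mul, abs_of_pos (inv_pos.2 hd')]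
  have hρ2 : (d : ℝ)⁻¹ * ∑ a, ρ.d (φ (σ s a)) (s • φ a) ^ 2 ≤ δ ^ 2 := by
    have h0 : 0 ≤ (1 / (d : ℝ)) * ∑ a, ρ.d (φ (σ s a)) (s • φ a) ^ 2 := by positivity
    have h1 := hφ s hs
    have hδ : 0 ≤ δ := (Real.sqrt_nonneg _).trans h1
    rw [rho2, Real.sqrt_le_left hδ, one_div] at h1
    exact h1
  calc (d : ℝ)⁻¹ * |∑ a, (h (s • φ a) - h (φ (σ s a)))|
      ≤ (d : ℝ)⁻¹ * ∑ a, (η + C * ρ.d (φ (σ s a)) (s • φ a) ^ 2) := by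
        gcongr
        refine (Finset.abs_sum_le_sum_abs _ _).trans (Finset.sum_le_sum fun a _ => ?_)
        rw [abs_sub_comm]
        exact hη _ _
    _ = η + C * ((d : ℝ)⁻¹ * ∑ a, ρ.d (φ (σ s a)) (s • φ a) ^ 2) := by
        rw [Finset.sum_add_distrib, ← Finset.mul_sum]
        simp only [Finset.sum_const, Finset.card_univ, Fintype.card_fin, nsmul_eq_mul]
        field_simp
    _ ≤ η + C * δ ^ 2 := by gcongr

/-- Approximately equivariant maps rarely visit small neighborhoods of a small set. -/
theorem eventually_card_filter_mem_le {G : Type*} [Group G] (Sap : SoficApprox G)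
    {X : Type*} [TopologicalSpace X] [CompactSpace X] [MetrizableSpace X]
    [MeasurableSpace X] [BorelSpace X] [MulAction G X] [ContinuousConstSMul G X]
    (ρ : ContPseudoMetric X) (hρ : ρ.IsCompatMetric) {K : ℕ → Set X}
    (hK : ∀ n, IsClosed (K n)) (hanti : Antitone K) (hsmall : IsSmallSet G (⋂ n, K n))
    {ε : ℝ} (hε : 0 < ε) :
    ∀ᶠ p : Finset G × ℕ in atTop, ∀ᶠ i in atTop,
      ∀ φ ∈ MapSpace ρ p.1 (1 / ((p.2 : ℝ) + 1)) (Sap.σ i),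
        ((Finset.univ.filter fun a => φ a ∈ K p.2).card : ℝ) ≤ ε * Sap.d i := by
  let _ := metrizableSpaceMetric X
  by_contra hcon
  rw [not_eventually] at hcon
  set bad : Set (Finset G × ℕ) := {p | ¬ ∀ᶠ i in atTop,
      ∀ φ ∈ MapSpace ρ p.1 (1 / ((p.2 : ℝ) + 1)) (Sap.σ i),
        ((Finset.univ.filter fun a => φ a ∈ K p.2).card : ℝ) ≤ ε * Sap.d i} with hbad
  have hμ : ∀ p ∈ bad, ∃ μ : ProbabilityMeasure X,
      ENNReal.ofReal ε ≤ (μ : Measure X) (K p.2) ∧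
      ∀ s ∈ p.1, ∀ h : X → ℝ, Continuous h → ∀ η C : ℝ, 0 ≤ C →
        (∀ x y, |h x - h y| ≤ η + C * ρ.d x y ^ 2) →
        |∫ x, h (s • x) ∂(μ : Measure X) - ∫ x, h x ∂(μ : Measure X)| ≤
          η + C * (1 / ((p.2 : ℝ) + 1)) ^ 2 := by
    intro p hp
    obtain ⟨i, hi, hdi⟩ := (Filter.Frequently.and_eventually (not_eventually.1 hp)
      (Sap.d_tendsto.eventually_ne_atTop 0)).exists
    push Not at hi
    obtain ⟨φ, hφ, hcard⟩ := hi
    refine ⟨⟨empiricalMeasure φ, isProbabilityMeasure_empiricalMeasure hdi φ⟩, ?_, ?_⟩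
    · change ENNReal.ofReal ε ≤ empiricalMeasure φ (K p.2)
      have hd' : (0 : ℝ) < Sap.d i := by exact_mod_cast Nat.pos_of_ne_zero hdi
      rw [empiricalMeasure_apply φ (hK _).measurableSet, ← ENNReal.ofReal_natCast,
        ← ENNReal.ofReal_inv_of_pos hd', ← ENNReal.ofReal_natCast,
        ← ENNReal.ofReal_mul (inv_pos.2 hd').le]
      refine ENNReal.ofReal_le_ofReal ?_
      rw [inv_mul_eq_div, le_div_iff₀ hd']
      exact hcard.le
    · intro s hs h hh η C hC hη
      exact abs_integral_empiricalMeasure_sub_le ρ hh hC hη hdi hφ hs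
  have : Nonempty (ProbabilityMeasure X) := by
    obtain ⟨p, hp⟩ := hcon.exists
    exact ⟨(hμ p hp).choose⟩
  choose! μ hμK hμinv using hμ
  have : (atTop ⊓ 𝓟 bad).NeBot := Filter.frequently_mem_iff_neBot.1 hcon
  let L : Ultrafilter (Finset G × ℕ) := Ultrafilter.of (atTop ⊓ 𝓟 bad)
  have hLtop : (L : Filter (Finset G × ℕ)) ≤ atTop := (Ultrafilter.of_le _).trans inf_le_left
  have hLbad : ∀ᶠ p in (L : Filter (Finset G × ℕ)), p ∈ bad :=
    ((Ultrafilter.of_le _).trans inf_le_right) (mem_principal_self bad)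
  have hLfst : ∀ s : G, ∀ᶠ p in (L : Filter (Finset G × ℕ)), s ∈ p.1 := fun s =>
    hLtop ((eventually_ge_atTop (({s}, 0) : Finset G × ℕ)).mono fun p hp =>
      hp.1 (Finset.mem_singleton_self s))
  have hLsnd : Tendsto (fun p : Finset G × ℕ => p.2) L atTop :=
    (tendsto_snd.mono_left (prod_atTop_atTop_eq (α := Finset G) (β := ℕ)).ge).mono_left hLtop
  obtain ⟨ν, -, hν⟩ := isCompact_univ.ultrafilter_le_nhds (L.map μ) (by simp)
  have hν : Tendsto μ L (𝓝 ν) := hν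
  have hint := ProbabilityMeasure.tendsto_iff_forall_integral_tendsto.1 hν
  have hinv : ∀ s : G, Measure.map (fun x => s • x) (ν : Measure X) = ν := by
    intro s
    have hs : Continuous fun x : X => s • x := continuous_const_smul s
    have : IsProbabilityMeasure (Measure.map (fun x => s • x) (ν : Measure X)) :=
      Measure.isProbabilityMeasure_map hs.aemeasurable
    refine ext_of_forall_integral_eq_of_IsFiniteMeasure fun h => ?_
    rw [integral_map hs.aemeasurable h.continuous.aestronglyMeasurable]
    have hdiff := ((hint (h.compContinuous ⟨_, hs⟩)).sub (hint h)).abs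
    rw [← sub_eq_zero, ← abs_nonpos_iff]
    refine le_of_forall_pos_le_add fun η hη => ?_
    obtain ⟨C, hC, hmod⟩ := exists_abs_sub_le_add_mul_sq ρ hρ h.continuous hη
    have hδ : Tendsto (fun p : Finset G × ℕ => η + C * (1 / ((p.2 : ℝ) + 1)) ^ 2) L
        (𝓝 (η + C * 0 ^ 2)) :=
      ((((tendsto_one_div_add_atTop_nhds_zero_nat (𝕜 := ℝ)).comp hLsnd).pow 2).const_mul
        C).const_add η
    have hle := le_of_tendsto_of_tendsto hdiff hδ (by
      filter_upwards [hLbad, hLfst s] with p hp hsp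
      exact hμinv p hp s hsp h h.continuous η C hC hmod)
    simpa using hle
  have hmeas : ∀ n, ENNReal.ofReal ε ≤ (ν : Measure X) (K n) := by
    intro n
    refine le_trans ?_ (ProbabilityMeasure.limsup_measure_closed_le_of_tendsto hν (hK n))
    refine le_limsup_of_frequently_le (Eventually.frequently ?_)
    filter_upwards [hLbad, hLsnd.eventually_ge_atTop n] with p hp hn
    exact (hμK p hp).trans (measure_mono (hanti hn))
  have hlim := tendsto_measure_iInter_atTop (μ := (ν : Measure X))
    (fun n => (hK n).measurableSet.nullMeasurableSet) hanti ⟨0, measure_ne_top _ _⟩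
  rw [hsmall ν inferInstance hinv] at hlim
  have := ge_of_tendsto' hlim hmeas
  simp [hε.not_ge] at this

/-- Under the small-boundary property, every finite open cover has a finite refinement by sets
with small frontier whose closures still refine the given cover. -/
theorem exists_finset_cover_small_frontier {G X : Type*} [Group G] [TopologicalSpace X]
    [CompactSpace X] [RegularSpace X] [MeasurableSpace X] [MulAction G X]
    (hSBP : ∀ x : X, ∀ U ∈ 𝓝 x, ∃ V ∈ 𝓝 x, V ⊆ U ∧ IsSmallSet G (frontier V))
    {𝒰 : Finset (Set X)} (h𝒰 : IsFinOpenCover 𝒰) :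
    ∃ (t : Finset X) (V : X → Set X), (∀ x, ∃ y ∈ t, x ∈ V y) ∧ (∀ x, (V x).Nonempty) ∧
      ∀ x, IsSmallSet G (frontier (V x)) ∧ ∃ U ∈ 𝒰, closure (V x) ⊆ U := by
  have hV : ∀ x : X, ∃ V ∈ 𝓝 x, IsSmallSet G (frontier V) ∧ ∃ U ∈ 𝒰, closure V ⊆ U := by
    intro x
    have hx : x ∈ ⋃ U ∈ 𝒰, U := h𝒰.2 ▸ Set.mem_univ x
    obtain ⟨U, hU, hxU⟩ := Set.mem_iUnion₂.1 hx
    obtain ⟨C, hC, hCc, hCU⟩ := exists_mem_nhds_isClosed_subset ((h𝒰.1 U hU).mem_nhds hxU)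
    obtain ⟨V, hV, hVC, hsmall⟩ := hSBP x C hC
    exact ⟨V, hV, hsmall, U, hU, (closure_minimal hVC hCc).trans hCU⟩
  choose V hVx hV using hV
  obtain ⟨t, -, ht⟩ := isCompact_univ.elim_nhds_subcover V fun x _ => hVx x
  refine ⟨t, V, fun x => ?_, fun x => ⟨x, mem_of_mem_nhds (hVx x)⟩, hV⟩
  simpa using ht (Set.mem_univ x)

/-- If a continuous action of a countable sofic group on a compact metrizable
space has the small-boundary property, then `mdim_Σ(X) ≤ 0`. -/
theorem mdimSigma_nonpos_of_SBP {G : Type*} [Group G] [Countable G] (Sap : SoficApprox G)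
    {X : Type*} [TopologicalSpace X] [CompactSpace X] [MetrizableSpace X]
    [MeasurableSpace X] [BorelSpace X]
    [MulAction G X] [ContinuousConstSMul G X]
    (hSBP : ∀ x : X, ∀ U ∈ 𝓝 x, ∃ V ∈ 𝓝 x, V ⊆ U ∧ IsSmallSet G (frontier V))
    (ρ : ContPseudoMetric X) (hρ : ρ.IsCompatMetric) :
    mdimSigma Sap ρ ≤ 0 := by
  let _ := metrizableSpaceMetric X
  refine iSup₂_le fun 𝒰 h𝒰 => ?_
  obtain ⟨t, V, hcov, hne, hV⟩ := exists_finset_cover_small_frontier hSBP h𝒰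
  have hclne : ∀ x, (closure (V x)).Nonempty := fun x => (hne x).closure
  let r : ℕ → ℝ := fun n => 1 / ((n : ℝ) + 1)
  have hr : ∀ n, 0 < r n := fun n => Nat.one_div_pos_of_nat
  have hrlim : Tendsto r atTop (𝓝 0) := tendsto_one_div_add_atTop_nhds_zero_nat
  have hranti : Antitone r := fun m n hmn => Nat.one_div_le_one_div hmn
  let K : X → ℕ → Set X := fun y n =>
    {x | Metric.infDist x (closure (V y)) ≤ r n} \ interior (V y)
  have hKclosed : ∀ y n, IsClosed (K y n) := fun y n =>
    (isClosed_le (Metric.continuous_infDist_pt _) continuous_const).sdiff isOpen_interior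
  have hKanti : ∀ y, Antitone (K y) := fun y m n hmn x hx => ⟨hx.1.trans (hranti hmn), hx.2⟩
  have hKsmall : ∀ y, IsSmallSet G (⋂ n, K y n) := by
    intro y
    have : (⋂ n, K y n) ⊆ frontier (V y) := by
      intro x hx
      rw [Set.mem_iInter] at hx
      refine ⟨?_, (hx 0).2⟩
      rw [isClosed_closure.mem_iff_infDist_zero (hclne y)]
      exact le_antisymm (ge_of_tendsto' hrlim fun n => (hx n).1) Metric.infDist_nonneg
    exact fun μ hμ hinv => measure_mono_null this ((hV y).1 μ hμ hinv)
  refine EReal.le_of_forall_lt_iff_le.1 fun ε hε => ?_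
  have hε : 0 < ε := by exact_mod_cast hε
  set ε' : ℝ := ε / ((t.card : ℝ) + 1) with hε'
  have hε'pos : 0 < ε' := by positivity
  have hrare : ∀ᶠ p : Finset G × ℕ in atTop, ∀ y ∈ t, ∀ᶠ i in atTop,
      ∀ φ ∈ MapSpace ρ p.1 (1 / ((p.2 : ℝ) + 1)) (Sap.σ i),
        ((Finset.univ.filter fun a => φ a ∈ K y p.2).card : ℝ) ≤ ε' * Sap.d i :=
    (Filter.eventually_all_finset t).2 fun y _ => by
      convert eventually_card_filter_mem_le Sap ρ hρ (hKclosed y) (hKanti y) (hKsmall y) hε'pos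
  have hthick : ∀ᶠ p : Finset G × ℕ in atTop, ∀ y ∈ t, ∃ U ∈ 𝒰,
      Metric.thickening (r p.2) (closure (V y)) ⊆ U := by
    refine (Filter.eventually_all_finset t).2 fun y _ => ?_
    obtain ⟨U, hU, hVU⟩ := (hV y).2
    obtain ⟨δ, hδ, hδU⟩ :=
      isClosed_closure.isCompact.exists_thickening_subset_open (h𝒰.1 U hU) hVU
    have hsnd : Tendsto (fun p : Finset G × ℕ => p.2) atTop atTop :=
      tendsto_snd.mono_left (prod_atTop_atTop_eq (α := Finset G) (β := ℕ)).ge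
    filter_upwards [(hrlim.comp hsnd).eventually (gt_mem_nhds hδ)] with p hp
    exact ⟨U, hU, (Metric.thickening_mono (le_of_lt hp) _).trans hδU⟩
  obtain ⟨⟨F, m⟩, hrare, hthick, hF⟩ := (hrare.and (hthick.and
    (eventually_ge_atTop (({1}, 0) : Finset G × ℕ)))).exists
  have hFne : F.Nonempty := ⟨1, hF.1 (Finset.mem_singleton_self 1)⟩
  refine (iInf_le _ ⟨F, hFne⟩).trans ((iInf_le _ ⟨r m, hr m⟩).trans ?_)
  refine limsup_le_of_le (by isBoundedDefault) ?_
  filter_upwards [(Filter.eventually_all_finset t).2 hrare,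
    Sap.d_tendsto.eventually_ne_atTop 0] with i hi hdi
  have hd : (0 : ℝ) < Sap.d i := by exact_mod_cast Nat.pos_of_ne_zero hdi
  let f : t → X → ℝ := fun y x => max 0 (1 - Metric.infDist x (closure (V y)) / r m)
  have hf : ∀ y, Continuous (f y) := fun y =>
    continuous_const.max (continuous_const.sub ((Metric.continuous_infDist_pt _).div_const _))
  have hf_pos : ∀ y x, 0 < f y x → Metric.infDist x (closure (V y)) < r m := by
    intro y x hx
    rcases lt_max_iff.1 hx with h | h
    · exact absurd h (lt_irrefl _)
    · rwa [sub_pos, div_lt_one (hr m)] at h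
  have hf_one : ∀ (y : t) x, x ∈ closure (V y) → f y x = 1 := by
    intro y x hx
    simp [f, Metric.infDist_zero_of_mem hx]
  have hbound := coverD_restrictCover_prodCover_le 𝒰 f hf (fun y x => le_max_left _ _)
    (fun y x => max_le zero_le_one (sub_le_self _ (div_nonneg Metric.infDist_nonneg (hr m).le)))
    (fun x => by
      obtain ⟨y, hy, hxy⟩ := hcov x
      exact ⟨⟨y, hy⟩, hf_one ⟨y, hy⟩ x (subset_closure hxy)⟩)
    (fun y => by
      obtain ⟨U, hU, hUsub⟩ := hthick y y.2
      refine ⟨U, hU, fun x hx => hUsub ?_⟩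
      rw [Metric.mem_thickening_iff_infDist_lt (hclne y)]
      exact hf_pos y x hx)
    (MapSpace ρ F (r m) (Sap.σ i)) (ε * Sap.d i) (by
      intro φ hφ
      have hsub : (Finset.univ.filter fun p : Fin (Sap.d i) × t =>
          ∀ n : ℤ, f p.2 (φ p.1) ≠ n) ⊆ (Finset.univ : Finset t).biUnion fun y =>
          (Finset.univ.filter fun a => φ a ∈ K y m).image fun a => (a, y) := by
        rintro ⟨a, y⟩ hp
        have hp := (Finset.mem_filter.1 hp).2
        simp only [Finset.mem_biUnion, Finset.mem_univ, true_and, Finset.mem_image,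
          Finset.mem_filter, Prod.mk.injEq]
        refine ⟨y, a, ⟨(hf_pos y _ ?_).le, fun hint => ?_⟩, rfl, rfl⟩
        · exact lt_of_le_of_ne (le_max_left _ _) fun h0 => hp 0 (by simpa using h0.symm)
        · exact hp 1 (by simpa using hf_one y _ (subset_closure (interior_subset hint)))
      have hcard := (Finset.card_le_card hsub).trans Finset.card_biUnion_le
      calc ((Finset.univ.filter fun p : Fin (Sap.d i) × t =>
            ∀ n : ℤ, f p.2 (φ p.1) ≠ n).card : ℝ)
          ≤ ∑ y : t, (((Finset.univ.filter fun a => φ a ∈ K y m).image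
              fun a => (a, y)).card : ℝ) := by exact_mod_cast hcard
        _ ≤ ∑ _y : t, ε' * Sap.d i := Finset.sum_le_sum fun y _ =>
            (Nat.cast_le.2 Finset.card_image_le).trans (hi y y.2 φ hφ)
        _ = ((t.card : ℝ) * ε') * Sap.d i := by simp [mul_assoc]
        _ ≤ ε * Sap.d i := by
            gcongr
            rw [hε', mul_div_assoc', div_le_iff₀ (by positivity)]
            nlinarith)
  have hinv : ((Sap.d i : ℝ) : EReal)⁻¹ = (((Sap.d i : ℝ)⁻¹ : ℝ) : EReal) :=
    (EReal.coe_inv _).symm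
  calc coverDMap 𝒰 ρ F (r m) (Sap.σ i) * ((Sap.d i : ℝ)⁻¹ : EReal)
      ≤ ((ε * Sap.d i : ℝ) : EReal) * ((Sap.d i : ℝ)⁻¹ : EReal) := by
        rw [hinv]
        exact mul_le_mul_of_nonneg_right hbound (by exact_mod_cast (inv_pos.2 hd).le)
    _ = (ε : EReal) := by
        rw [hinv, ← EReal.coe_mul, mul_inv_cancel_right₀ hd.ne']

end SoficMD
end
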